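/- arXiv:1502.07064 — 5 statements merged into one kernel-verified Lean document; each statement's English description precedes it below -/
import Mathlib

section
/- Let (Ω, Σ, μ) be a finite measure space and let T : L¹(μ) → L¹(μ) be a bounded linear operator. Then there exists a unique positive bounded linear operator |T| : L¹(μ) → L¹(μ) such that for every f ∈ L¹(μ) with f ≥ 0, |T| f is the least upper bound in L¹(μ) of the set {|T g| : g ∈ L¹(μ), |g| ≤ f}. Moreover, this operator satisfies ‖|T|‖ = ‖T‖ and |T f| ≤ |T| |f| for all f ∈ L¹(μ). -/
open MeasureTheory

/-- `PartitionSum T f x` says that `x = ∑ |T fᵢ|` for some finite decomposition `f = ∑ fᵢ`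
into nonnegative elements. -/
inductive PartitionSum {E : Type*} [NormedAddCommGroup E] [Lattice E] [NormedSpace ℝ E]
    (T : E →L[ℝ] E) : E → E → Prop
  | single (f : E) (hf : 0 ≤ f) : PartitionSum T f |T f|
  | add (f g x y : E) (hx : PartitionSum T f x) (hy : PartitionSum T g y) :
      PartitionSum T (f + g) (x + y)

/-- The Riesz decomposition property, for two decompositions of the same nonnegative element. -/
theorem riesz_refinement {G : Type*} [AddCommGroup G] [Lattice G] [IsOrderedAddMonoid G]
    {f g p q : G} (hf : 0 ≤ f) (hg : 0 ≤ g) (hp : 0 ≤ p) (hq : 0 ≤ q) (h : f + g = p + q) :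
    ∃ a b c d : G, 0 ≤ a ∧ 0 ≤ b ∧ 0 ≤ c ∧ 0 ≤ d ∧
      a + b = f ∧ c + d = g ∧ a + c = p ∧ b + d = q := by
  refine ⟨f ⊓ p, f - f ⊓ p, p - f ⊓ p, g - (p - f ⊓ p), le_inf hf hp,
    sub_nonneg.2 inf_le_left, sub_nonneg.2 inf_le_right, ?_, by abel, by abel, by abel, ?_⟩
  · have h₁ : p - g ≤ f ⊓ p := by
      refine le_inf ?_ (sub_le_self _ hg)
      rw [sub_le_iff_le_add, h]
      exact le_add_of_nonneg_right hq
    rw [sub_nonneg, sub_le_comm]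
    exact h₁
  · rw [eq_sub_of_add_eq h]
    abel

section BanachLattice

variable {E : Type*} [NormedAddCommGroup E] [Lattice E] [IsOrderedAddMonoid E]

/-- A norm-bounded directed set of nonnegative elements in a Banach lattice whose norm is additive
on the positive cone has a least upper bound, with the same norm bound. -/
theorem exists_isLUB_of_directedOn_of_norm_add [HasSolidNorm E] [CompleteSpace E]
    (hadd : ∀ a b : E, 0 ≤ a → 0 ≤ b → ‖a + b‖ = ‖a‖ + ‖b‖)
    {D : Set E} (hne : D.Nonempty) (hdir : DirectedOn (· ≤ ·) D) (hpos : ∀ d ∈ D, 0 ≤ d)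
    {C : ℝ} (hC : ∀ d ∈ D, ‖d‖ ≤ C) : ∃ s, IsLUB D s ∧ ‖s‖ ≤ C := by
  have hsub : ∀ a ∈ D, ∀ b, a ≤ b → ‖b - a‖ = ‖b‖ - ‖a‖ := by
    intro a ha b hab
    have := hadd a (b - a) (hpos a ha) (sub_nonneg.2 hab)
    rw [add_sub_cancel] at this
    linarith
  have hbdd : BddAbove (norm '' D) := ⟨C, by rintro _ ⟨d, hd, rfl⟩; exact hC d hd⟩
  set c := sSup (norm '' D) with hc
  have hle : ∀ d ∈ D, ‖d‖ ≤ c := fun d hd => le_csSup hbdd ⟨d, hd, rfl⟩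
  have hex : ∀ n : ℕ, ∃ d ∈ D, c - 1 / ((n : ℝ) + 1) < ‖d‖ := by
    intro n
    have hlt : c - 1 / ((n : ℝ) + 1) < c := sub_lt_self _ Nat.one_div_pos_of_nat
    obtain ⟨_, ⟨d, hd, rfl⟩, h⟩ := exists_lt_of_lt_csSup (hne.image _) hlt
    exact ⟨d, hd, h⟩
  choose d hdD hdc using hex
  choose! j hjD hjl hjr using hdir
  have hnear : ∀ n, ∀ e ∈ D, ‖j (d n) e - d n‖ ≤ 1 / ((n : ℝ) + 1) := by
    intro n e he
    have hj := hjD (d n) (hdD n) e he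
    rw [hsub _ (hdD n) _ (hjl _ (hdD n) _ he)]
    linarith [hle _ hj, hdc n]
  have hnear_right : ∀ n m, ‖j (d n) (d m) - d m‖ ≤ 1 / ((m : ℝ) + 1) := by
    intro n m
    have hj := hjD (d n) (hdD n) (d m) (hdD m)
    rw [hsub _ (hdD m) _ (hjr _ (hdD n) _ (hdD m))]
    linarith [hle _ hj, hdc m]
  have hlim : Filter.Tendsto (fun n : ℕ => 1 / ((n : ℝ) + 1)) Filter.atTop (nhds 0) :=
    tendsto_one_div_add_atTop_nhds_zero_nat
  have hcauchy : CauchySeq d := by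
    refine cauchySeq_of_le_tendsto_0 (fun n : ℕ => 1 / ((n : ℝ) + 1) + 1 / ((n : ℝ) + 1)) ?_
      (by simpa using hlim.add hlim)
    intro n m N hn hm
    have hn' := Nat.one_div_le_one_div (α := ℝ) hn
    have hm' := Nat.one_div_le_one_div (α := ℝ) hm
    rw [dist_eq_norm]
    calc ‖d n - d m‖ = ‖(j (d n) (d m) - d m) - (j (d n) (d m) - d n)‖ := by congr 1; abel
      _ ≤ ‖j (d n) (d m) - d m‖ + ‖j (d n) (d m) - d n‖ := norm_sub_le _ _
      _ ≤ _ := by linarith [hnear_right n m, hnear n _ (hdD m)]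
  obtain ⟨s, hs⟩ := cauchySeq_tendsto_of_complete hcauchy
  refine ⟨s, ⟨fun e he => ?_, fun b hb => le_of_tendsto' hs fun n => hb (hdD n)⟩,
    le_of_tendsto' hs.norm fun n => hC _ (hdD n)⟩
  have hdiff : Filter.Tendsto (fun n => j (d n) e - d n) Filter.atTop (nhds 0) :=
    squeeze_zero_norm (fun n => hnear n e he) hlim
  have hj : Filter.Tendsto (fun n => j (d n) e) Filter.atTop (nhds s) := by
    simpa using hdiff.add hs
  exact ge_of_tendsto' hj fun n => hjr _ (hdD n) _ he

variable [NormedSpace ℝ E] {T : E →L[ℝ] E}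

namespace PartitionSum

theorem nonneg_left {f x : E} (h : PartitionSum T f x) : 0 ≤ f := by
  induction h with
  | single f hf => exact hf
  | add f g x y _ _ ihx ihy => exact add_nonneg ihx ihy

theorem nonneg {f x : E} (h : PartitionSum T f x) : 0 ≤ x := by
  induction h with
  | single f hf => exact abs_nonneg _
  | add f g x y _ _ ihx ihy => exact add_nonneg ihx ihy

theorem abs_apply_le {f x : E} (h : PartitionSum T f x) : |T f| ≤ x := by
  induction h with
  | single f hf => exact le_rfl
  | add f g x y _ _ ihx ihy =>
    rw [map_add]
    exact (abs_add_le _ _).trans (add_le_add ihx ihy)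

theorem norm_le [HasSolidNorm E]
    (hadd : ∀ a b : E, 0 ≤ a → 0 ≤ b → ‖a + b‖ = ‖a‖ + ‖b‖) {f x : E}
    (h : PartitionSum T f x) : ‖x‖ ≤ ‖T‖ * ‖f‖ := by
  induction h with
  | single f hf =>
    rw [norm_abs_eq_norm]
    exact T.le_opNorm f
  | add f g x y hx hy ihx ihy =>
    rw [hadd f g hx.nonneg_left hy.nonneg_left, mul_add]
    exact (norm_add_le x y).trans (add_le_add ihx ihy)

/-- A partition sum for `f + g` is dominated by partition sums for `f` and `g`. -/
theorem exists_le_add {f g x : E} (hf : 0 ≤ f) (hg : 0 ≤ g) (h : PartitionSum T (f + g) x) :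
    ∃ a b, PartitionSum T f a ∧ PartitionSum T g b ∧ x ≤ a + b := by
  generalize hk : f + g = k at h
  induction h generalizing f g with
  | single k _ =>
    refine ⟨_, _, single f hf, single g hg, ?_⟩
    rw [← hk, map_add]
    exact abs_add_le _ _
  | add p q x y hx hy ihx ihy =>
    obtain ⟨a, b, c, d, ha, hb, hc, hd, rfl, rfl, hp, hq⟩ :=
      riesz_refinement hf hg hx.nonneg_left hy.nonneg_left hk
    obtain ⟨xa, xc, hxa, hxc, hle⟩ := ihx ha hc hp
    obtain ⟨yb, yd, hyb, hyd, hle'⟩ := ihy hb hd hq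
    refine ⟨_, _, add _ _ _ _ hxa hyb, add _ _ _ _ hxc hyd, (add_le_add hle hle').trans_eq ?_⟩
    abel

theorem directed {f x y : E} (hx : PartitionSum T f x) (hy : PartitionSum T f y) :
    ∃ z, PartitionSum T f z ∧ x ≤ z ∧ y ≤ z := by
  induction hx generalizing y with
  | single f hf => exact ⟨y, hy, hy.abs_apply_le, le_rfl⟩
  | add p q x x' hx hx' ihx ihx' =>
    obtain ⟨a, b, ha, hb, hle⟩ := hy.exists_le_add hx.nonneg_left hx'.nonneg_left
    obtain ⟨z, hz, hxz, haz⟩ := ihx ha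
    obtain ⟨z', hz', hxz', hbz'⟩ := ihx' hb
    exact ⟨_, add _ _ _ _ hz hz', add_le_add hxz hxz', hle.trans (add_le_add haz hbz')⟩

theorem add_le_of_forall {f x : E} (h : PartitionSum T f x) (b c : E)
    (hb : ∀ g, |g| ≤ f → c + T g ≤ b) : c + x ≤ b := by
  induction h generalizing b c with
  | single f hf =>
    rw [abs, add_sup]
    refine sup_le (hb f (abs_of_nonneg hf).le) ?_
    rw [← map_neg]
    exact hb (-f) (by rw [abs_neg, abs_of_nonneg hf])
  | add p q x y _ _ ihx ihy =>
    rw [add_comm x y, ← add_assoc]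
    refine ihx b (c + y) fun g hg => ?_
    rw [add_right_comm]
    refine ihy b (c + T g) fun k hk => ?_
    rw [add_assoc, ← map_add]
    exact hb _ ((abs_add_le g k).trans (add_le_add hg hk))

end PartitionSum

/-- A bounded additive map on the positive cone of a Banach lattice whose norm is additive on that
cone extends to a bounded linear operator. -/
theorem exists_clm_of_additive_on_nonneg [HasSolidNorm E]
    (hadd : ∀ a b : E, 0 ≤ a → 0 ≤ b → ‖a + b‖ = ‖a‖ + ‖b‖) (S : E → E)
    (hS : ∀ f g, 0 ≤ f → 0 ≤ g → S (f + g) = S f + S g) {C : ℝ} (hC : 0 ≤ C)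
    (hbound : ∀ f, 0 ≤ f → ‖S f‖ ≤ C * ‖f‖) :
    ∃ M : E →L[ℝ] E, (∀ f, 0 ≤ f → M f = S f) ∧ ‖M‖ ≤ C := by
  have hzero : S 0 = 0 := by simpa using hS 0 0 le_rfl le_rfl
  let A : E →+ E :=
    { toFun := fun f => S f⁺ - S f⁻
      map_zero' := by simp
      map_add' := by
        intro f g
        have hparts : (f + g)⁺ + (f⁻ + g⁻) = (f + g)⁻ + (f⁺ + g⁺) := by
          have h₁ := posPart_sub_negPart (f + g)
          have h₂ := posPart_sub_negPart f
          have h₃ := posPart_sub_negPart g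
          rw [← sub_eq_zero]
          calc _ = ((f + g)⁺ - (f + g)⁻) - ((f⁺ - f⁻) + (g⁺ - g⁻)) := by abel
            _ = 0 := by rw [h₁, h₂, h₃, sub_self]
        have h := congrArg S hparts
        rw [hS _ _ (posPart_nonneg _) (add_nonneg (negPart_nonneg _) (negPart_nonneg _)),
          hS _ _ (negPart_nonneg _) (negPart_nonneg _),
          hS _ _ (negPart_nonneg _) (add_nonneg (posPart_nonneg _) (posPart_nonneg _)),
          hS _ _ (posPart_nonneg _) (posPart_nonneg _)] at h
        rw [← sub_eq_zero] at h ⊢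
        rw [← h]
        abel }
  have hA : ∀ f, ‖A f‖ ≤ C * ‖f‖ := by
    intro f
    calc ‖S f⁺ - S f⁻‖ ≤ ‖S f⁺‖ + ‖S f⁻‖ := norm_sub_le _ _
      _ ≤ C * ‖f⁺‖ + C * ‖f⁻‖ :=
        add_le_add (hbound _ (posPart_nonneg _)) (hbound _ (negPart_nonneg _))
      _ = C * ‖f‖ := by
        rw [← mul_add, ← hadd _ _ (posPart_nonneg _) (negPart_nonneg _), posPart_add_negPart,
          norm_abs_eq_norm]
  refine ⟨A.toRealLinearMap (AddMonoidHomClass.continuous_of_bound A C hA), fun f hf => ?_,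
    ContinuousLinearMap.opNorm_le_bound _ hC hA⟩
  change S f⁺ - S f⁻ = S f
  rw [posPart_of_nonneg hf, negPart_of_nonneg hf, hzero, sub_zero]

/-- Existence of the modulus, with the norm bound `‖M‖ ≤ ‖T‖`. -/
theorem exists_modulus_of_norm_add [HasSolidNorm E] [CompleteSpace E]
    (hadd : ∀ a b : E, 0 ≤ a → 0 ≤ b → ‖a + b‖ = ‖a‖ + ‖b‖) (T : E →L[ℝ] E) :
    ∃ M : E →L[ℝ] E, (∀ f, 0 ≤ f → 0 ≤ M f) ∧
      (∀ f, 0 ≤ f → IsLUB {h | ∃ g, |g| ≤ f ∧ h = |T g|} (M f)) ∧ ‖M‖ ≤ ‖T‖ := by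
  have hex : ∀ f : E, 0 ≤ f → ∃ s, IsLUB {x | PartitionSum T f x} s ∧ ‖s‖ ≤ ‖T‖ * ‖f‖ := by
    intro f hf
    refine exists_isLUB_of_directedOn_of_norm_add hadd ⟨_, PartitionSum.single f hf⟩ ?_
      (fun x hx => hx.nonneg) (fun x hx => hx.norm_le hadd)
    exact fun x hx y hy => hx.directed hy
  choose! S hLUB hbound using hex
  have hS : ∀ f g, 0 ≤ f → 0 ≤ g → S (f + g) = S f + S g := by
    intro f g hf hg
    refine le_antisymm ((hLUB _ (add_nonneg hf hg)).2 fun x hx => ?_) ?_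
    · obtain ⟨a, b, ha, hb, hle⟩ := PartitionSum.exists_le_add hf hg hx
      exact hle.trans (add_le_add ((hLUB f hf).1 ha) ((hLUB g hg).1 hb))
    · rw [← le_sub_iff_add_le]
      refine (hLUB f hf).2 fun a ha => ?_
      rw [le_sub_comm]
      refine (hLUB g hg).2 fun b hb => ?_
      rw [le_sub_iff_add_le']
      exact (hLUB _ (add_nonneg hf hg)).1 (.add _ _ _ _ ha hb)
  obtain ⟨M, hM, hnorm⟩ := exists_clm_of_additive_on_nonneg hadd S hS (norm_nonneg T) hbound
  have habs : ∀ f, 0 ≤ f → |T f| ≤ M f := fun f hf => by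
    rw [hM f hf]
    exact (hLUB f hf).1 (.single f hf)
  have hpos : ∀ f, 0 ≤ f → 0 ≤ M f := fun f hf => (abs_nonneg _).trans (habs f hf)
  refine ⟨M, hpos, fun f hf => ⟨?_, fun b hb => ?_⟩, hnorm⟩
  · rintro _ ⟨g, hg, rfl⟩
    calc |T g| = |T g⁺ + -T g⁻| := by
          rw [← sub_eq_add_neg, ← map_sub, posPart_sub_negPart]
      _ ≤ |T g⁺| + |T g⁻| := by simpa using abs_add_le (T g⁺) (-T g⁻)
      _ ≤ M g⁺ + M g⁻ :=
        add_le_add (habs _ (posPart_nonneg _)) (habs _ (negPart_nonneg _))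
      _ = M |g| := by rw [← map_add, posPart_add_negPart]
      _ ≤ M f := by
        rw [← sub_nonneg, ← map_sub]
        exact hpos _ (sub_nonneg.2 hg)
  · rw [hM f hf]
    refine (hLUB f hf).2 fun x hx => ?_
    have := PartitionSum.add_le_of_forall hx b 0 fun g hg => by
      rw [zero_add]
      exact (le_abs_self _).trans (hb ⟨g, hg, rfl⟩)
    rwa [zero_add] at this

end BanachLattice

/-- The `L¹` norm is additive on the positive cone. -/
theorem MeasureTheory.Lp.norm_add_of_nonneg {Ω : Type*} [MeasurableSpace Ω] {μ : Measure Ω}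
    (a b : Lp ℝ 1 μ) (ha : 0 ≤ a) (hb : 0 ≤ b) : ‖a + b‖ = ‖a‖ + ‖b‖ := by
  rw [L1.norm_eq_integral_norm, L1.norm_eq_integral_norm, L1.norm_eq_integral_norm,
    ← integral_add (L1.integrable_coeFn a).norm (L1.integrable_coeFn b).norm]
  refine integral_congr_ae ?_
  filter_upwards [Lp.coeFn_add a b, (Lp.coeFn_nonneg a).2 ha, (Lp.coeFn_nonneg b).2 hb]
    with x hx hax hbx
  simp only [Pi.zero_apply] at hax hbx
  rw [hx, Pi.add_apply, Real.norm_of_nonneg hax, Real.norm_of_nonneg hbx,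
    Real.norm_of_nonneg (add_nonneg hax hbx)]

/-- The strong modulus of a bounded linear operator on `L¹(μ)` of a finite measure space:
there is a unique positive bounded linear operator `M = |T|` such that for every `f ≥ 0`,
`M f` is the least upper bound of `{|T g| : |g| ≤ f}`; moreover `‖M‖ = ‖T‖` and
`|T f| ≤ M |f|` for all `f`. -/
theorem modulus_exists_unique_L1 {Ω : Type*} [MeasurableSpace Ω] (μ : Measure Ω)
    [IsFiniteMeasure μ] (T : Lp ℝ 1 μ →L[ℝ] Lp ℝ 1 μ) :
    ∃ M : Lp ℝ 1 μ →L[ℝ] Lp ℝ 1 μ,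
      ((∀ f : Lp ℝ 1 μ, 0 ≤ f → 0 ≤ M f) ∧
        (∀ f : Lp ℝ 1 μ, 0 ≤ f →
          IsLUB {h : Lp ℝ 1 μ | ∃ g : Lp ℝ 1 μ, |g| ≤ f ∧ h = |T g|} (M f))) ∧
      (∀ M' : Lp ℝ 1 μ →L[ℝ] Lp ℝ 1 μ,
        ((∀ f : Lp ℝ 1 μ, 0 ≤ f → 0 ≤ M' f) ∧
          (∀ f : Lp ℝ 1 μ, 0 ≤ f →
            IsLUB {h : Lp ℝ 1 μ | ∃ g : Lp ℝ 1 μ, |g| ≤ f ∧ h = |T g|} (M' f))) → M' = M) ∧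
      ‖M‖ = ‖T‖ ∧ (∀ f : Lp ℝ 1 μ, |T f| ≤ M |f|) := by
  obtain ⟨M, hpos, hLUB, hnorm⟩ := exists_modulus_of_norm_add Lp.norm_add_of_nonneg T
  have habs : ∀ f, |T f| ≤ M |f| := fun f => (hLUB |f| (abs_nonneg f)).1 ⟨f, le_rfl, rfl⟩
  refine ⟨M, ⟨hpos, hLUB⟩, ?_, le_antisymm hnorm ?_, habs⟩
  · rintro M' ⟨-, hLUB'⟩
    ext1 f
    rw [← posPart_sub_negPart f, map_sub, map_sub,
      (hLUB' _ (posPart_nonneg f)).unique (hLUB _ (posPart_nonneg f)),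
      (hLUB' _ (negPart_nonneg f)).unique (hLUB _ (negPart_nonneg f))]
  · refine T.opNorm_le_bound (norm_nonneg M) fun f => ?_
    calc ‖T f‖ ≤ ‖M |f|‖ := norm_le_norm_of_abs_le_abs ((habs f).trans (le_abs_self _))
      _ ≤ ‖M‖ * ‖f‖ := by simpa only [norm_abs_eq_norm] using M.le_opNorm |f|
end

section
/- Let (Ω, Σ, μ) be a finite measure space, let 1 ≤ p < ∞, and let T : L^p(μ) → L^p(μ) be a bounded linear operator which is majorizable, i.e. there exists a positive bounded linear operator S : L^p(μ) → L^p(μ) with |T f| ≤ S |f| for all f ∈ L^p(μ). Then there exists a unique positive bounded linear operator |T| : L^p(μ) → L^p(μ) such that for every f ≥ 0 in L^p(μ), |T| f is the least upper bound of {|T g| : g ∈ L^p(μ), |g| ≤ f}; moreover |T f| ≤ |T| |f| for all f ∈ L^p(μ), one has |T| f ≤ S f for every f ≥ 0, and consequently ‖|T|‖ ≤ ‖S‖. -/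
open scoped ENNReal
open MeasureTheory

section LatticeGroup

variable {E : Type*} [AddCommGroup E] [Lattice E] [IsOrderedAddMonoid E]

/-- The Riesz decomposition property for elements of arbitrary sign. -/
theorem exists_add_of_abs_le_add {f₁ f₂ g : E} (h₁ : 0 ≤ f₁) (h₂ : 0 ≤ f₂)
    (hg : |g| ≤ f₁ + f₂) : ∃ g₁ g₂ : E, g = g₁ + g₂ ∧ |g₁| ≤ f₁ ∧ |g₂| ≤ f₂ := by
  obtain ⟨hg_lower, hg_upper⟩ := abs_le'.1 hg |>.symm
  have hneg : -f₁ ≤ f₁ := (neg_nonpos.2 h₁).trans h₁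
  have hlow : -(f₁ + f₂) ≤ g := neg_le.1 hg_lower
  refine ⟨(g ⊓ f₁) ⊔ -f₁, g - ((g ⊓ f₁) ⊔ -f₁), by abel, ?_, ?_⟩
  · exact abs_le'.2 ⟨sup_le inf_le_right hneg, neg_le.1 le_sup_right⟩
  · refine abs_le'.2 ⟨?_, ?_⟩
    · rw [sub_le_comm]
      refine le_sup_of_le_left (le_inf (sub_le_self _ h₂) ?_)
      rwa [sub_le_iff_le_add]
    · rw [neg_sub, sub_le_iff_le_add]
      refine sup_le (inf_le_left.trans (le_add_of_nonneg_left h₂)) ?_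
      calc -f₁ = f₂ + -(f₁ + f₂) := by abel
        _ ≤ f₂ + g := by gcongr

theorem abs_add_abs_le_abs_add_sup_abs_sub (a b : E) : |a| + |b| ≤ |a + b| ⊔ |a - b| := by
  have key : ∀ x : E, x ≤ |a + b| ⊔ |a - b| - b → x ≤ |a + b| ⊔ |a - b| - -b →
      x ≤ |a + b| ⊔ |a - b| - |b| := fun x hx hx' => by
    rw [le_sub_comm] at hx hx' ⊢
    exact sup_le hx hx'
  rw [← le_sub_iff_add_le]
  refine sup_le (key _ ?_ ?_) (key _ ?_ ?_) <;> rw [le_sub_iff_add_le]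
  · exact le_sup_of_le_left (le_abs_self _)
  · exact le_sup_of_le_right (by simpa [sub_eq_add_neg] using le_abs_self (a - b))
  · exact le_sup_of_le_right (by simpa [sub_eq_add_neg, add_comm] using neg_le_abs (a - b))
  · exact le_sup_of_le_left (by simpa [add_comm] using neg_le_abs (a + b))

/-- A map that is additive on the positive cone extends to an additive map. -/
theorem exists_addMonoidHom_eq_of_nonneg {F : Type*} [AddCommGroup F] (m : E → F)
    (hadd : ∀ f g : E, 0 ≤ f → 0 ≤ g → m (f + g) = m f + m g) :
    ∃ M : E →+ F, (∀ f, 0 ≤ f → M f = m f) ∧ ∀ f, M f = m f⁺ - m f⁻ := by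
  have hzero : m 0 = 0 := by simpa using hadd 0 0 le_rfl le_rfl
  refine ⟨AddMonoidHom.mk' (fun f => m f⁺ - m f⁻) fun f g => ?_, fun f hf => ?_, fun f => rfl⟩
  · have hparts : (f + g)⁺ + (f⁻ + g⁻) = (f⁺ + g⁺) + (f + g)⁻ := by
      have h := posPart_sub_negPart (f + g)
      have hf := posPart_sub_negPart f
      have hg := posPart_sub_negPart g
      rw [← sub_eq_zero]
      calc _ = ((f + g)⁺ - (f + g)⁻) - (f⁺ - f⁻) - (g⁺ - g⁻) := by abel
        _ = 0 := by rw [h, hf, hg]; abel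
    have hm := congrArg m hparts
    rw [hadd _ _ (posPart_nonneg _) (add_nonneg (negPart_nonneg _) (negPart_nonneg _)),
      hadd _ _ (negPart_nonneg _) (negPart_nonneg _),
      hadd _ _ (add_nonneg (posPart_nonneg _) (posPart_nonneg _)) (negPart_nonneg _),
      hadd _ _ (posPart_nonneg _) (posPart_nonneg _)] at hm
    rw [← sub_eq_zero] at hm ⊢
    rw [← hm]
    abel
  · simp [posPart_of_nonneg hf, negPart_of_nonneg hf, hzero]

/-- If the modulus of an additive map exists pointwise on the positive cone, it is additive
there. -/
theorem isLUB_abs_image_add {F : Type*} [AddCommGroup F] [Lattice F] [IsOrderedAddMonoid F]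
    (T : E →+ F) {f₁ f₂ : E} {a₁ a₂ : F} (h₁ : 0 ≤ f₁) (h₂ : 0 ≤ f₂)
    (ha₁ : IsLUB {h | ∃ g, |g| ≤ f₁ ∧ h = |T g|} a₁)
    (ha₂ : IsLUB {h | ∃ g, |g| ≤ f₂ ∧ h = |T g|} a₂) :
    IsLUB {h | ∃ g, |g| ≤ f₁ + f₂ ∧ h = |T g|} (a₁ + a₂) := by
  refine ⟨?_, fun x hx => ?_⟩
  · rintro _ ⟨g, hg, rfl⟩
    obtain ⟨g₁, g₂, rfl, hg₁, hg₂⟩ := exists_add_of_abs_le_add h₁ h₂ hg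
    rw [map_add]
    exact (abs_add_le _ _).trans (add_le_add (ha₁.1 ⟨g₁, hg₁, rfl⟩) (ha₂.1 ⟨g₂, hg₂, rfl⟩))
  · rw [← le_sub_iff_add_le]
    refine ha₁.2 ?_
    rintro _ ⟨g₁, hg₁, rfl⟩
    rw [le_sub_comm]
    refine ha₂.2 ?_
    rintro _ ⟨g₂, hg₂, rfl⟩
    rw [le_sub_iff_add_le']
    refine (abs_add_abs_le_abs_add_sup_abs_sub _ _).trans (sup_le ?_ ?_)
    · exact hx ⟨g₁ + g₂, (abs_add_le _ _).trans (add_le_add hg₁ hg₂), by rw [map_add]⟩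
    · refine hx ⟨g₁ - g₂, ?_, by rw [map_sub]⟩
      rw [sub_eq_add_neg]
      exact (abs_add_le _ _).trans (add_le_add hg₁ (by rwa [abs_neg]))

end LatticeGroup

/-- A majorized bounded operator on a Dedekind complete normed lattice has a modulus. -/
theorem ContinuousLinearMap.exists_modulus_of_majorized {E : Type*} [NormedAddCommGroup E]
    [Lattice E] [IsOrderedAddMonoid E] [HasSolidNorm E] [NormedSpace ℝ E]
    (hE : ∀ s : Set E, s.Nonempty → BddAbove s → ∃ a, IsLUB s a) (T S : E →L[ℝ] E)
    (hSpos : ∀ f : E, 0 ≤ f → 0 ≤ S f) (hmaj : ∀ f : E, |T f| ≤ S |f|) :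
    ∃ M : E →L[ℝ] E, (∀ f : E, 0 ≤ f → 0 ≤ M f) ∧
      (∀ f : E, 0 ≤ f → IsLUB {h : E | ∃ g : E, |g| ≤ f ∧ h = |T g|} (M f)) ∧
      (∀ f : E, 0 ≤ f → M f ≤ S f) ∧ ‖M‖ ≤ ‖S‖ := by
  have hSub : ∀ f : E, S f ∈ upperBounds {h : E | ∃ g : E, |g| ≤ f ∧ h = |T g|} := by
    rintro f _ ⟨g, hg, rfl⟩
    refine (hmaj g).trans ?_
    simpa using hSpos _ (sub_nonneg.2 hg)
  have hex : ∀ f : E, ∃ a, 0 ≤ f → IsLUB {h : E | ∃ g : E, |g| ≤ f ∧ h = |T g|} a := by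
    intro f
    by_cases hf : 0 ≤ f
    · obtain ⟨a, ha⟩ := hE {h : E | ∃ g : E, |g| ≤ f ∧ h = |T g|}
        ⟨_, 0, by simpa using hf, rfl⟩ ⟨S f, hSub f⟩
      exact ⟨a, fun _ => ha⟩
    · exact ⟨0, fun h => absurd h hf⟩
  choose m hm using hex
  have hm_nonneg : ∀ f, 0 ≤ f → 0 ≤ m f := fun f hf =>
    (hm f hf).1 ⟨0, by simpa using hf, by simp⟩
  have hm_le : ∀ f, 0 ≤ f → m f ≤ S f := fun f hf => (hm f hf).2 (hSub f)
  have hm_add : ∀ f g, 0 ≤ f → 0 ≤ g → m (f + g) = m f + m g := fun f g hf hg =>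
    (hm _ (add_nonneg hf hg)).unique
      (isLUB_abs_image_add (T : E →ₗ[ℝ] E).toAddMonoidHom hf hg (hm f hf) (hm g hg))
  obtain ⟨M₀, hM₀, hM₀_parts⟩ := exists_addMonoidHom_eq_of_nonneg m hm_add
  have hbound : ∀ f, ‖M₀ f‖ ≤ ‖S‖ * ‖f‖ := by
    intro f
    have habs : |M₀ f| ≤ abs (S |f|) := by
      have hp := hm_nonneg _ (posPart_nonneg f)
      have hn := hm_nonneg _ (negPart_nonneg f)
      calc |M₀ f| ≤ m f⁺ + m f⁻ := by
            rw [hM₀_parts]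
            refine abs_le'.2 ⟨(sub_le_self _ hn).trans (le_add_of_nonneg_right hn), ?_⟩
            rw [neg_sub]
            exact (sub_le_self _ hp).trans (le_add_of_nonneg_left hp)
        _ = m |f| := by
            rw [← hm_add _ _ (posPart_nonneg f) (negPart_nonneg f), posPart_add_negPart]
        _ ≤ S |f| := hm_le _ (abs_nonneg f)
        _ ≤ abs (S |f|) := le_abs_self _
    calc ‖M₀ f‖ ≤ ‖S |f|‖ := norm_le_norm_of_abs_le_abs habs
      _ ≤ ‖S‖ * ‖|f|‖ := S.le_opNorm _
      _ = ‖S‖ * ‖f‖ := by rw [norm_abs_eq_norm]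
  refine ⟨M₀.toRealLinearMap (AddMonoidHomClass.continuous_of_bound M₀ ‖S‖ hbound),
    fun f hf => ?_, fun f hf => ?_, fun f hf => ?_,
    ContinuousLinearMap.opNorm_le_bound _ (norm_nonneg S) hbound⟩
  · exact (hm_nonneg f hf).trans_eq (hM₀ f hf).symm
  · exact (hM₀ f hf).symm ▸ hm f hf
  · exact (hM₀ f hf).trans_le (hm_le f hf)

namespace MeasureTheory.Lp

variable {Ω : Type*} [MeasurableSpace Ω] {μ : Measure Ω} {p : ℝ≥0∞}

theorem exists_isLUB_range_of_bddAbove (u : ℕ → Lp ℝ p μ) (hu : BddAbove (Set.range u)) :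
    ∃ g, IsLUB (Set.range u) g := by
  obtain ⟨b, hb⟩ := hu
  have hub : ∀ᵐ x ∂μ, ∀ n, u n x ≤ b x :=
    ae_all_iff.2 fun n => (coeFn_le _ _).2 (hb ⟨n, rfl⟩)
  have hmeas : AEStronglyMeasurable (fun x => ⨆ n, u n x) μ :=
    (Measurable.iSup fun n => (Lp.stronglyMeasurable (u n)).measurable).aestronglyMeasurable
  have hmem : MemLp (fun x => ⨆ n, u n x) p μ := by
    refine ((Lp.memLp (u 0)).norm.add (Lp.memLp b).norm).of_le hmeas ?_
    filter_upwards [hub] with x hx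
    have h₀ : u 0 x ≤ ⨆ n, u n x :=
      le_ciSup (f := fun n => u n x) ⟨b x, by rintro _ ⟨n, rfl⟩; exact hx n⟩ 0
    have h₁ : ⨆ n, u n x ≤ b x := ciSup_le hx
    simp only [Pi.add_apply, Real.norm_eq_abs]
    refine le_trans (abs_le.2 ⟨?_, ?_⟩) (le_abs_self _)
    · linarith [neg_abs_le (u 0 x), abs_nonneg (b x)]
    · linarith [le_abs_self (b x), abs_nonneg (u 0 x)]
  refine ⟨hmem.toLp _, ?_, fun c hc => ?_⟩
  · rintro _ ⟨n, rfl⟩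
    rw [← coeFn_le]
    filter_upwards [hub, hmem.coeFn_toLp] with x hx hgx
    rw [hgx]
    exact le_ciSup (f := fun n => u n x) ⟨b x, by rintro _ ⟨n, rfl⟩; exact hx n⟩ n
  · rw [← coeFn_le]
    have huc : ∀ᵐ x ∂μ, ∀ n, u n x ≤ c x :=
      ae_all_iff.2 fun n => (coeFn_le _ _).2 (hc ⟨n, rfl⟩)
    filter_upwards [huc, hmem.coeFn_toLp] with x hx hgx
    rw [hgx]
    exact ciSup_le hx

variable [IsFiniteMeasure μ] [hp : Fact (1 ≤ p)]

theorem integrable_of_isFiniteMeasure (f : Lp ℝ p μ) : Integrable f μ :=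
  (Lp.memLp f).integrable hp.out

theorem integral_mono_of_le {f g : Lp ℝ p μ} (h : f ≤ g) : ∫ x, f x ∂μ ≤ ∫ x, g x ∂μ :=
  integral_mono_ae (integrable_of_isFiniteMeasure f) (integrable_of_isFiniteMeasure g)
    ((coeFn_le _ _).2 h)

/-- `L^p` of a finite measure is Dedekind complete. -/
theorem exists_isLUB_of_bddAbove (s : Set (Lp ℝ p μ)) (hs : s.Nonempty) (hb : BddAbove s) :
    ∃ g, IsLUB s g := by
  let φ : Lp ℝ p μ → ℝ := fun f => ∫ x, f x ∂μ
  have hφ_sub : ∀ f g : Lp ℝ p μ, φ (f - g) = φ f - φ g := fun f g => by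
    rw [← integral_sub (integrable_of_isFiniteMeasure f) (integrable_of_isFiniteMeasure g)]
    exact integral_congr_ae (coeFn_sub f g)
  have hD : BddAbove (φ '' supClosure s) := by
    obtain ⟨b, hb⟩ := hb
    rw [← upperBounds_supClosure] at hb
    refine ⟨φ b, ?_⟩
    rintro _ ⟨f, hf, rfl⟩
    exact integral_mono_of_le (hb hf)
  have hne : (φ '' supClosure s).Nonempty := (hs.mono subset_supClosure).image φ
  have hseq : ∀ n : ℕ, ∃ f ∈ supClosure s, sSup (φ '' supClosure s) - 1 / ((n : ℝ) + 1) < φ f := by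
    intro n
    obtain ⟨_, ⟨f, hf, rfl⟩, h⟩ :=
      exists_lt_of_lt_csSup hne (sub_lt_self _ (Nat.one_div_pos_of_nat (α := ℝ) (n := n)))
    exact ⟨f, hf, h⟩
  choose u hu hφu using hseq
  have huD : Set.range u ⊆ supClosure s := by
    rintro _ ⟨n, rfl⟩
    exact hu n
  obtain ⟨g, hg⟩ := exists_isLUB_range_of_bddAbove u
    (BddAbove.mono huD (by rwa [BddAbove, upperBounds_supClosure]))
  refine ⟨g, ?_, fun c hc => hg.2 fun f hf => ?_⟩
  · intro d hd
    have hexcess : ∀ n : ℕ, φ (g ⊔ d - g) ≤ 1 / ((n : ℝ) + 1) := by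
      intro n
      have hle : g ⊔ d - g ≤ u n ⊔ d - u n := by
        rw [sup_sub, sup_sub, sub_self, sub_self]
        exact sup_le_sup_left (sub_le_sub_left (hg.1 ⟨n, rfl⟩) d) 0
      have h₁ : φ (g ⊔ d - g) ≤ φ (u n ⊔ d - u n) := integral_mono_of_le hle
      have h₂ : φ (u n ⊔ d) ≤ sSup (φ '' supClosure s) :=
        le_csSup hD ⟨_, supClosed_supClosure (hu n) (subset_supClosure hd), rfl⟩
      rw [hφ_sub (u n ⊔ d)] at h₁
      linarith [hφu n]
    have hnonneg : 0 ≤ g ⊔ d - g := sub_nonneg.2 le_sup_left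
    have hzero : φ (g ⊔ d - g) = 0 :=
      le_antisymm (ge_of_tendsto' tendsto_one_div_add_atTop_nhds_zero_nat hexcess)
        (integral_nonneg_of_ae ((coeFn_nonneg _).2 hnonneg))
    have hae := (integral_eq_zero_iff_of_nonneg_ae ((coeFn_nonneg _).2 hnonneg)
      (integrable_of_isFiniteMeasure _)).1 hzero
    have heq : g ⊔ d = g := sub_eq_zero.1 ((eq_zero_iff_ae_eq_zero).2 hae)
    exact sup_eq_left.1 heq
  · rw [← upperBounds_supClosure] at hc
    exact hc (huD hf)

end MeasureTheory.Lp

/-- A majorizable bounded linear operator `T` on `L^p(μ)` (`1 ≤ p < ∞`) of a finite measure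
space, with majorant `S`, admits a unique modulus `M = |T|`; moreover `|T f| ≤ M |f|` for all
`f`, `M f ≤ S f` for `f ≥ 0`, and `‖M‖ ≤ ‖S‖`. -/
theorem modulus_exists_unique_of_majorizable {Ω : Type*} [MeasurableSpace Ω] (μ : Measure Ω)
    [IsFiniteMeasure μ] (p : ℝ≥0∞) [Fact (1 ≤ p)] (hp : p ≠ ∞)
    (T S : Lp ℝ p μ →L[ℝ] Lp ℝ p μ)
    (hSpos : ∀ f : Lp ℝ p μ, 0 ≤ f → 0 ≤ S f)
    (hmaj : ∀ f : Lp ℝ p μ, |T f| ≤ S |f|) :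
    ∃ M : Lp ℝ p μ →L[ℝ] Lp ℝ p μ,
      ((∀ f : Lp ℝ p μ, 0 ≤ f → 0 ≤ M f) ∧
        (∀ f : Lp ℝ p μ, 0 ≤ f →
          IsLUB {h : Lp ℝ p μ | ∃ g : Lp ℝ p μ, |g| ≤ f ∧ h = |T g|} (M f))) ∧
      (∀ M' : Lp ℝ p μ →L[ℝ] Lp ℝ p μ,
        ((∀ f : Lp ℝ p μ, 0 ≤ f → 0 ≤ M' f) ∧
          (∀ f : Lp ℝ p μ, 0 ≤ f →
            IsLUB {h : Lp ℝ p μ | ∃ g : Lp ℝ p μ, |g| ≤ f ∧ h = |T g|} (M' f))) → M' = M) ∧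
      (∀ f : Lp ℝ p μ, |T f| ≤ M |f|) ∧
      (∀ f : Lp ℝ p μ, 0 ≤ f → M f ≤ S f) ∧
      ‖M‖ ≤ ‖S‖ := by
  obtain ⟨M, hMpos, hMlub, hMle, hMnorm⟩ :=
    ContinuousLinearMap.exists_modulus_of_majorized Lp.exists_isLUB_of_bddAbove T S hSpos hmaj
  refine ⟨M, ⟨hMpos, hMlub⟩, ?_, fun f => (hMlub _ (abs_nonneg f)).1 ⟨f, le_rfl, rfl⟩, hMle,
    hMnorm⟩
  rintro M' ⟨-, hM'lub⟩
  have hcone : ∀ f, 0 ≤ f → M' f = M f := fun f hf => (hM'lub f hf).unique (hMlub f hf)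
  refine ContinuousLinearMap.ext fun f => ?_
  rw [← posPart_sub_negPart f, map_sub, map_sub, hcone _ (posPart_nonneg f),
    hcone _ (negPart_nonneg f)]
end

section
/- Let (Ω, Σ, μ) be a σ-finite measure space and let T : L^∞(μ) → L^∞(μ) be a positive linear contraction. Then either ‖T^{n+1} − T^n‖ = 2 for every n ∈ ℕ, or lim_{n→∞} ‖T^{n+1} − T^n‖ = 0. -/
open scoped ENNReal
open MeasureTheory Filter

namespace ZeroTwoLaw

section Binomial

/-- Summation by parts along a sequence that increases up to `r` and decreases afterwards. -/
theorem norm_sum_smul_sub_succ_le {F : Type*} [SeminormedAddCommGroup F] [NormedSpace ℝ F]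
    (a : ℕ → ℝ) (x : ℕ → F) (r : ℕ) (hx : ∀ j, ‖x j‖ ≤ 1) (ha₀ : 0 ≤ a 0)
    (hmono : ∀ j, j < r → a j ≤ a (j + 1)) (hanti : ∀ j, r ≤ j → a (j + 1) ≤ a j)
    (d : ℕ) :
    ‖∑ j ∈ Finset.range (r + d), a j • (x j - x (j + 1)) + a (r + d) • x (r + d)‖
      ≤ 2 * a r - a (r + d) := by
  have step : ∀ n, ‖∑ j ∈ Finset.range (n + 1), a j • (x j - x (j + 1)) + a (n + 1) • x (n + 1)‖
      ≤ ‖∑ j ∈ Finset.range n, a j • (x j - x (j + 1)) + a n • x n‖ + |a (n + 1) - a n| := by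
    intro n
    have h : ∑ j ∈ Finset.range (n + 1), a j • (x j - x (j + 1)) + a (n + 1) • x (n + 1)
        = (∑ j ∈ Finset.range n, a j • (x j - x (j + 1)) + a n • x n)
          + (a (n + 1) - a n) • x (n + 1) := by
      rw [Finset.sum_range_succ]
      module
    rw [h]
    refine (norm_add_le _ _).trans (add_le_add le_rfl ?_)
    rw [norm_smul, Real.norm_eq_abs]
    exact mul_le_of_le_one_right (abs_nonneg _) (hx _)
  have up : ∀ n, n ≤ r →
      ‖∑ j ∈ Finset.range n, a j • (x j - x (j + 1)) + a n • x n‖ ≤ a n := by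
    intro n
    induction n with
    | zero =>
      intro _
      simpa [norm_smul, abs_of_nonneg ha₀] using mul_le_of_le_one_right ha₀ (hx 0)
    | succ n ih =>
      intro hn
      have h := hmono n hn
      have := step n
      rw [abs_of_nonneg (sub_nonneg.2 h)] at this
      linarith [ih (by omega)]
  induction d with
  | zero =>
    have := up r le_rfl
    simp only [add_zero]
    linarith
  | succ d ih =>
    have h := hanti (r + d) (by omega)
    have := step (r + d)
    rw [abs_of_nonpos (sub_nonpos.2 h)] at this
    rw [← add_assoc]
    linarith

theorem choose_two_mul_succ_le {r j : ℕ} (hj : r ≤ j) :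
    (2 * r).choose (j + 1) ≤ (2 * r).choose j := by
  have h := Nat.choose_succ_right_eq (2 * r) j
  refine Nat.le_of_mul_le_mul_right (c := j + 1) ?_ (Nat.succ_pos j)
  rw [h]
  exact Nat.mul_le_mul_left _ (by omega)

theorem centralBinom_sq_mul_le (r : ℕ) :
    ((r.centralBinom : ℝ) / 4 ^ r) ^ 2 * (2 * r + 1) ≤ 1 := by
  induction r with
  | zero => simp
  | succ r ih =>
    have h : ((r : ℝ) + 1) * (r + 1).centralBinom = 2 * (2 * r + 1) * r.centralBinom := by
      exact_mod_cast Nat.succ_mul_centralBinom_succ r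
    have h' : ((r + 1).centralBinom : ℝ) / 4 ^ (r + 1)
        = (r.centralBinom : ℝ) / 4 ^ r * ((2 * r + 1) / (2 * (r + 1))) := by
      field_simp
      rw [pow_succ]
      linear_combination 2 * 4 ^ r * h
    rw [h', mul_pow]
    push_cast
    have h2 : ((2 * (r : ℝ) + 1) / (2 * (r + 1))) ^ 2 * (2 * (r + 1) + 1) ≤ 2 * r + 1 := by
      rw [div_pow, div_mul_eq_mul_div, div_le_iff₀ (by positivity)]
      nlinarith [(Nat.cast_nonneg r : (0 : ℝ) ≤ r)]
    calc _ = ((r.centralBinom : ℝ) / 4 ^ r) ^ 2 *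
          (((2 * (r : ℝ) + 1) / (2 * (r + 1))) ^ 2 * (2 * (r + 1) + 1)) := by ring
      _ ≤ ((r.centralBinom : ℝ) / 4 ^ r) ^ 2 * (2 * r + 1) := by gcongr
      _ ≤ 1 := ih

theorem tendsto_centralBinom_div_four_pow :
    Tendsto (fun r : ℕ => (r.centralBinom : ℝ) / 4 ^ r) atTop (nhds 0) := by
  have hsq : Tendsto (fun r : ℕ => ((r.centralBinom : ℝ) / 4 ^ r) ^ 2) atTop (nhds 0) := by
    refine squeeze_zero (fun r => sq_nonneg _) (fun r => ?_)
      tendsto_one_div_add_atTop_nhds_zero_nat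
    rw [le_div_iff₀ (by positivity)]
    refine le_trans ?_ (centralBinom_sq_mul_le r)
    gcongr
    linarith [(Nat.cast_nonneg r : (0 : ℝ) ≤ r)]
  refine (Real.sqrt_zero ▸ hsq.sqrt).congr fun r => ?_
  exact Real.sqrt_sq (by positivity)

end Binomial

section Average

variable {E : Type*} [NormedAddCommGroup E] [NormedSpace ℝ E]

/-- The average `(1 + T) / 2`. -/
noncomputable def halfAverage (T : E →L[ℝ] E) : E →L[ℝ] E := (2⁻¹ : ℝ) • (1 + T)

theorem halfAverage_apply (T : E →L[ℝ] E) (f : E) :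
    halfAverage T f = (2⁻¹ : ℝ) • (f + T f) := rfl

theorem commute_halfAverage (T : E →L[ℝ] E) : Commute T (halfAverage T) :=
  ((Commute.one_right T).add_right (Commute.refl T)).smul_right _

theorem norm_pow_le_one {T : E →L[ℝ] E} (hT : ‖T‖ ≤ 1) (n : ℕ) : ‖T ^ n‖ ≤ 1 := by
  induction n with
  | zero => exact ContinuousLinearMap.norm_id_le
  | succ n ih =>
    rw [pow_succ]
    exact (norm_mul_le _ _).trans (mul_le_one₀ ih (norm_nonneg _) hT)

theorem norm_halfAverage_le {T : E →L[ℝ] E} (hT : ‖T‖ ≤ 1) : ‖halfAverage T‖ ≤ 1 := by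
  have h1 : ‖(1 : E →L[ℝ] E)‖ ≤ 1 := ContinuousLinearMap.norm_id_le
  have h2 := norm_add_le 1 T
  rw [halfAverage, norm_smul, Real.norm_eq_abs, abs_of_pos (by norm_num)]
  linarith

theorem norm_halfAverage_pow_mul_le {T : E →L[ℝ] E} (hT : ‖T‖ ≤ 1) (r : ℕ) :
    ‖halfAverage T ^ (2 * r) * (1 - T)‖ ≤ 2 * ((r.centralBinom : ℝ) / 4 ^ r) := by
  have hsum : (1 + T) ^ (2 * r) * (1 - T)
      = ∑ j ∈ Finset.range (r + (r + 1)),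
          ((2 * r).choose j : ℝ) • (T ^ j - T ^ (j + 1)) := by
    rw [add_comm 1 T, (Commute.one_right T).add_pow, Finset.sum_mul,
      show 2 * r + 1 = r + (r + 1) by omega]
    refine Finset.sum_congr rfl fun j _ => ?_
    rw [Nat.cast_smul_eq_nsmul ℝ, nsmul_eq_mul, one_pow, mul_one, pow_succ,
      ← (Nat.cast_commute _ _).eq, mul_assoc, mul_sub, mul_one]
  have hbound := norm_sum_smul_sub_succ_le (fun j => ((2 * r).choose j : ℝ)) (fun j => T ^ j) r
    (norm_pow_le_one hT) (Nat.cast_nonneg _)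
    (fun j hj => Nat.cast_le.2 (Nat.choose_le_succ_of_lt_half_left (by omega)))
    (fun j hj => Nat.cast_le.2 (choose_two_mul_succ_le hj)) (r + 1)
  have hzero : (2 * r).choose (r + (r + 1)) = 0 := Nat.choose_eq_zero_of_lt (by omega)
  simp only [hzero, Nat.cast_zero, zero_smul, add_zero, sub_zero] at hbound
  rw [halfAverage, smul_pow, smul_mul_assoc, norm_smul, hsum, norm_pow, Real.norm_eq_abs,
    abs_of_pos (by norm_num : (0 : ℝ) < 2⁻¹), pow_mul, Nat.centralBinom_eq_two_mul_choose]
  calc ((2⁻¹ : ℝ) ^ 2) ^ r * _ ≤ ((2⁻¹ : ℝ) ^ 2) ^ r * (2 * ((2 * r).choose r : ℝ)) := by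
        gcongr
    _ = _ := by
        rw [show ((2⁻¹ : ℝ) ^ 2) = 4⁻¹ by norm_num, inv_pow]
        ring

theorem antitone_norm_pow_succ_sub_pow {T : E →L[ℝ] E} (hT : ‖T‖ ≤ 1) :
    Antitone fun n : ℕ => ‖T ^ (n + 1) - T ^ n‖ := by
  refine antitone_nat_of_succ_le fun n => ?_
  rw [show T ^ (n + 1 + 1) - T ^ (n + 1) = T * (T ^ (n + 1) - T ^ n) by
    rw [mul_sub, ← pow_succ', ← pow_succ']]
  exact (norm_mul_le _ _).trans (mul_le_of_le_one_left (norm_nonneg _) hT)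

end Average

section OrderUnit

variable {E : Type*} [NormedAddCommGroup E] [Lattice E] [NormedSpace ℝ E]

/-- A positive element `e` of norm at most one whose order interval `[-e, e]` is the unit ball. -/
structure IsNormUnit (e : E) : Prop where
  nonneg : 0 ≤ e
  norm_le : ‖e‖ ≤ 1
  le_norm_smul : ∀ f : E, f ≤ ‖f‖ • e

/-- Positivity of a continuous linear functional. -/
def IsPos (l : E →L[ℝ] ℝ) : Prop := ∀ f : E, 0 ≤ f → 0 ≤ l f

/-- Positivity of a continuous linear operator. -/
def IsPosOp (T : E →L[ℝ] E) : Prop := ∀ f : E, 0 ≤ f → 0 ≤ T f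

theorem IsNormUnit.norm_le_of_abs_le [HasSolidNorm E] {e : E} (he : IsNormUnit e) {f : E}
    {C : ℝ} (hC : 0 ≤ C) (h : |f| ≤ C • e) : ‖f‖ ≤ C := by
  have h1 : ‖f‖ ≤ ‖C • e‖ := norm_le_norm_of_abs_le_abs (h.trans (le_abs_self _))
  rw [norm_smul, Real.norm_eq_abs, abs_of_nonneg hC] at h1
  exact h1.trans (mul_le_of_le_one_right hC he.norm_le)

theorem IsPos.comp {l : E →L[ℝ] ℝ} (hl : IsPos l) {T : E →L[ℝ] E} (hT : IsPosOp T) :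
    IsPos (l.comp T) := fun f hf => hl _ (hT f hf)

theorem IsPosOp.pow {T : E →L[ℝ] E} (hT : IsPosOp T) (n : ℕ) : IsPosOp (T ^ n) := by
  induction n with
  | zero => exact fun f hf => hf
  | succ n ih =>
    intro f hf
    rw [pow_succ]
    exact ih _ (hT f hf)

variable [IsOrderedAddMonoid E]

theorem IsPos.mono {l : E →L[ℝ] ℝ} (hl : IsPos l) {f g : E} (h : f ≤ g) : l f ≤ l g := by
  have := hl (g - f) (sub_nonneg.2 h)
  rw [map_sub] at this
  linarith

theorem IsPos.le_norm_mul {e : E} (he : IsNormUnit e) {l : E →L[ℝ] ℝ} (hl : IsPos l) (f : E) :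
    |l f| ≤ l e * ‖f‖ := by
  have h1 := hl.mono (he.le_norm_smul f)
  have h2 := hl.mono (he.le_norm_smul (-f))
  simp only [map_smul, map_neg, norm_neg, smul_eq_mul] at h1 h2
  exact abs_le.2 ⟨by linarith, by linarith⟩

variable [PosSMulMono ℝ E]

theorem IsPosOp.halfAverage {T : E →L[ℝ] E} (hT : IsPosOp T) : IsPosOp (halfAverage T) :=
  fun f hf => smul_nonneg (by norm_num) (add_nonneg hf (hT f hf))

theorem IsNormUnit.apply_le {e : E} (he : IsNormUnit e) {T : E →L[ℝ] E} (hT : ‖T‖ ≤ 1) :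
    T e ≤ e := by
  have h : ‖T e‖ ≤ 1 := (T.le_opNorm e).trans (mul_le_one₀ hT (norm_nonneg _) he.norm_le)
  simpa using (he.le_norm_smul (T e)).trans (smul_le_smul_of_nonneg_right h he.nonneg)

/-- Among the functionals dominated on the positive cone by two sublinear functions, a positive
one can be prescribed at one point up to the infimal convolution of the two functions. -/
theorem exists_isPos_le_le {e : E} (he : IsNormUnit e) (p q : E → ℝ)
    (hp : ∀ a, 0 ≤ a → 0 ≤ p a) (hq : ∀ a, 0 ≤ a → 0 ≤ q a)
    (hp_add : ∀ a b, p (a + b) ≤ p a + p b) (hq_add : ∀ a b, q (a + b) ≤ q a + q b)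
    (hp_smul : ∀ (t : ℝ) (a : E), 0 ≤ t → p (t • a) = t * p a)
    (hq_smul : ∀ (t : ℝ) (a : E), 0 ≤ t → q (t • a) = t * q a)
    (x : E) (c : ℝ) (hc : 0 ≤ c)
    (hx : ∀ a b, 0 ≤ a → 0 ≤ b → x ≤ a + b → c ≤ p a + q b) :
    ∃ l : E →L[ℝ] ℝ, IsPos l ∧ (∀ f, 0 ≤ f → l f ≤ p f) ∧ (∀ f, 0 ≤ f → l f ≤ q f) ∧
      l x = c := by
  have hp0 : p 0 = 0 := by simpa using hp_smul 0 0 le_rfl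
  have hq0 : q 0 = 0 := by simpa using hq_smul 0 0 le_rfl
  let A : E → Set ℝ := fun f => {s | ∃ a b, 0 ≤ a ∧ 0 ≤ b ∧ f ≤ a + b ∧ p a + q b = s}
  have hA_nonneg : ∀ f, ∀ s ∈ A f, 0 ≤ s := by
    rintro f s ⟨a, b, ha, hb, -, rfl⟩
    exact add_nonneg (hp a ha) (hq b hb)
  have hA_bdd : ∀ f, BddBelow (A f) := fun f => ⟨0, hA_nonneg f⟩
  have hA_ne : ∀ f, (A f).Nonempty := fun f =>
    ⟨_, |f|, 0, abs_nonneg f, le_rfl, by simpa using le_abs_self f, rfl⟩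
  let N : E → ℝ := fun f => sInf (A f)
  have hN_le : ∀ f a b, 0 ≤ a → 0 ≤ b → f ≤ a + b → N f ≤ p a + q b :=
    fun f a b ha hb h => csInf_le (hA_bdd f) ⟨a, b, ha, hb, h, rfl⟩
  have hN_nonneg : ∀ f, 0 ≤ N f := fun f => le_csInf (hA_ne f) (hA_nonneg f)
  have hN_smul_le : ∀ t : ℝ, 0 < t → ∀ f, N (t • f) ≤ t * N f := by
    intro t ht f
    rw [← div_le_iff₀' ht]
    refine le_csInf (hA_ne f) ?_
    rintro s ⟨a, b, ha, hb, h, rfl⟩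
    rw [div_le_iff₀' ht, mul_add, ← hp_smul t a ht.le, ← hq_smul t b ht.le]
    refine hN_le _ _ _ (smul_nonneg ht.le ha) (smul_nonneg ht.le hb) ?_
    rw [← smul_add]
    exact smul_le_smul_of_nonneg_left h ht.le
  have hN_smul : ∀ t : ℝ, 0 < t → ∀ f, N (t • f) = t * N f := by
    intro t ht f
    refine le_antisymm (hN_smul_le t ht f) ?_
    have h := hN_smul_le t⁻¹ (inv_pos.2 ht) (t • f)
    rw [smul_smul, inv_mul_cancel₀ ht.ne', one_smul, ← div_eq_inv_mul, le_div_iff₀' ht] at h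
    exact h
  have hN_add : ∀ f g, N (f + g) ≤ N f + N g := by
    intro f g
    rw [← sub_le_iff_le_add]
    refine le_csInf (hA_ne f) ?_
    rintro s ⟨a, b, ha, hb, h, rfl⟩
    rw [sub_le_iff_le_add, ← sub_le_iff_le_add']
    refine le_csInf (hA_ne g) ?_
    rintro s ⟨a', b', ha', hb', h', rfl⟩
    rw [sub_le_iff_le_add']
    have h1 := hN_le (f + g) (a + a') (b + b') (add_nonneg ha ha') (add_nonneg hb hb')
      (by rw [add_add_add_comm]; exact add_le_add h h')
    linarith [hp_add a a', hq_add b b']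
  have hcx : c ≤ N x := by
    refine le_csInf (hA_ne x) ?_
    rintro s ⟨a, b, ha, hb, h, rfl⟩
    exact hx a b ha hb h
  have hspan : ∀ t : ℝ, t * c ≤ N (t • x) := by
    intro t
    rcases lt_or_ge 0 t with ht | ht
    · rw [hN_smul t ht]
      exact mul_le_mul_of_nonneg_left hcx ht.le
    · exact (mul_nonpos_of_nonpos_of_nonneg ht hc).trans (hN_nonneg _)
  have hker : ∀ t : ℝ, t • x = 0 → t • c = 0 := by
    intro t ht
    have hN0 : N 0 ≤ 0 := by simpa [hp0, hq0] using hN_le 0 0 0 le_rfl le_rfl (by simp)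
    have h1 := hspan t
    have h2 := hspan (-t)
    rw [neg_smul] at h2
    rw [ht] at h1 h2
    rw [neg_zero] at h2
    rw [smul_eq_mul]
    linarith
  obtain ⟨l, hl_ext, hl_le⟩ := exists_extension_of_le_sublinear
    (LinearPMap.mkSpanSingleton' x c hker) N hN_smul hN_add (by
      rintro ⟨y, hy⟩
      obtain ⟨t, rfl⟩ := Submodule.mem_span_singleton.1 hy
      rw [LinearPMap.mkSpanSingleton'_apply]
      exact hspan t)
  have hl_pos : ∀ f, 0 ≤ f → 0 ≤ l f := by
    intro f hf
    have h1 := (hl_le (-f)).trans (hN_le (-f) 0 0 le_rfl le_rfl (by simpa using hf))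
    rw [map_neg, hp0, hq0] at h1
    linarith
  have hl_mono : ∀ f g, f ≤ g → l f ≤ l g := by
    intro f g h
    have := hl_pos (g - f) (sub_nonneg.2 h)
    rw [map_sub] at this
    linarith
  refine ⟨l.mkContinuous (l e) fun f => ?_, hl_pos, fun f hf => ?_, fun f hf => ?_, ?_⟩
  · have h1 := hl_mono _ _ (he.le_norm_smul f)
    have h2 := hl_mono _ _ (he.le_norm_smul (-f))
    simp only [map_smul, map_neg, norm_neg, smul_eq_mul] at h1 h2
    exact abs_le.2 ⟨by linarith, by linarith⟩
  · simpa [hq0] using (hl_le f).trans (hN_le f f 0 hf le_rfl (by simp))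
  · simpa [hp0] using (hl_le f).trans (hN_le f 0 f le_rfl hf (by simp))
  · exact (hl_ext ⟨x, Submodule.mem_span_singleton_self x⟩).trans
      (LinearPMap.mkSpanSingleton'_apply_self x c hker _)

variable [HasSolidNorm E]

/-- Positive functionals are norming. -/
theorem norm_le_of_forall_isPos {e : E} (he : IsNormUnit e) {g : E} {C : ℝ} (hC : 0 ≤ C)
    (h : ∀ l : E →L[ℝ] ℝ, IsPos l → l e ≤ 1 → |l g| ≤ C) : ‖g‖ ≤ C := by
  have key : ∀ f : E, (∀ l : E →L[ℝ] ℝ, IsPos l → l e ≤ 1 → l f ≤ C) → f ≤ C • e := by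
    intro f hf
    obtain ⟨l, hl, hle, -, hlf⟩ := exists_isPos_le_le he norm norm (fun a _ => norm_nonneg a)
      (fun a _ => norm_nonneg a) norm_add_le norm_add_le
      (fun t a ht => by rw [norm_smul, Real.norm_eq_abs, abs_of_nonneg ht])
      (fun t a ht => by rw [norm_smul, Real.norm_eq_abs, abs_of_nonneg ht]) f ‖f⁺‖ (norm_nonneg _)
      (fun a b ha hb hab => by
        refine (norm_le_norm_of_abs_le_abs ?_).trans (norm_add_le a b)
        rw [abs_of_nonneg (posPart_nonneg f), abs_of_nonneg (add_nonneg ha hb)]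
        exact sup_le hab (add_nonneg ha hb))
    have h1 : ‖f⁺‖ ≤ C := hlf ▸ hf l hl ((hle e he.nonneg).trans he.norm_le)
    exact (le_posPart f).trans ((he.le_norm_smul _).trans
      (smul_le_smul_of_nonneg_right h1 he.nonneg))
  refine he.norm_le_of_abs_le hC (abs_le'.2 ⟨
    key g fun l hl hl1 => (le_abs_self _).trans (h l hl hl1),
    key (-g) fun l hl hl1 => ?_⟩)
  rw [map_neg]
  exact (neg_le_abs _).trans (h l hl hl1)

/-- Two positive functionals have a common minorant of any mass up to that of their infimum. -/
theorem exists_common_minorant {e : E} (he : IsNormUnit e) {l₁ l₂ : E →L[ℝ] ℝ}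
    (h₁ : IsPos l₁) (h₂ : IsPos l₂) {c : ℝ} (hc : 0 ≤ c)
    (hcl : 2 * c ≤ l₁ e + l₂ e - ‖l₁ - l₂‖) :
    ∃ u : E →L[ℝ] ℝ, IsPos u ∧ (∀ f, 0 ≤ f → u f ≤ l₁ f) ∧ (∀ f, 0 ≤ f → u f ≤ l₂ f) ∧
      u e = c := by
  refine exists_isPos_le_le he l₁ l₂ h₁ h₂ (fun a b => (map_add l₁ a b).le)
    (fun a b => (map_add l₂ a b).le) (fun t a _ => by simp) (fun t a _ => by simp) e c hc ?_
  intro a b ha hb hab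
  have h1 : l₁ (a ⊓ e) ≤ l₁ a := h₁.mono inf_le_left
  have h2 : l₂ (e - a ⊓ e) ≤ l₂ b := by
    refine h₂.mono ?_
    rw [sub_le_comm]
    exact le_inf (sub_le_iff_le_add.2 hab) (sub_le_self _ hb)
  have h0 : 0 ≤ a ⊓ e := le_inf ha he.nonneg
  have hnorm : ‖e - (2 : ℝ) • (a ⊓ e)‖ ≤ 1 := by
    refine he.norm_le_of_abs_le zero_le_one (abs_le'.2 ⟨?_, ?_⟩)
    · rw [one_smul]
      exact sub_le_self _ (smul_nonneg zero_le_two h0)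
    · rw [one_smul, neg_sub, sub_le_iff_le_add, two_smul]
      exact add_le_add inf_le_right inf_le_right
  have h3 := ((le_abs_self _).trans ((l₁ - l₂).le_opNorm (e - (2 : ℝ) • (a ⊓ e)))).trans
    (mul_le_of_le_one_right (norm_nonneg _) hnorm)
  simp only [sub_apply, map_sub, map_smul, smul_eq_mul] at h3 h2
  linarith

variable {T : E →L[ℝ] E} {e : E}

/-- One step: `l ∘ T ^ (n + 1)` is a part factoring through `(1 + T) / 2` plus a positive remainder
of mass at most `(1 - δ) * l e`. -/
theorem exists_decomp (he : IsNormUnit e) (hTpos : IsPosOp T) (hT : ‖T‖ ≤ 1) {n : ℕ} {δ : ℝ}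
    (hδ : 0 ≤ δ) (hn : ‖T ^ (n + 1) - T ^ n‖ ≤ 2 - 4 * δ) {l : E →L[ℝ] ℝ} (hl : IsPos l) :
    ∃ a r : E →L[ℝ] ℝ, IsPos a ∧ IsPos r ∧ l.comp (T ^ (n + 1)) = a.comp (halfAverage T) + r ∧
      a e ≤ δ * l e ∧ r e ≤ (1 - δ) * l e := by
  set l₁ := l.comp (T ^ n) with hl₁
  set l₂ := l.comp (T ^ (n + 1)) with hl₂
  have hp₁ : IsPos l₁ := hl.comp (hTpos.pow n)
  have hp₂ : IsPos l₂ := hl.comp (hTpos.pow (n + 1))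
  have hle : 0 ≤ l e := hl e he.nonneg
  have hl₁e : l₁ e ≤ l e := hl.mono (he.apply_le (norm_pow_le_one hT n))
  have hl₂e : l₂ e ≤ l e := hl.mono (he.apply_le (norm_pow_le_one hT (n + 1)))
  have hnorm_le : ∀ k : E →L[ℝ] ℝ, IsPos k → ‖k‖ ≤ k e := fun k hk =>
    k.opNorm_le_bound (hk e he.nonneg) fun f => hk.le_norm_mul he f
  have hdiff : ‖l₁ - l₂‖ ≤ (2 - 4 * δ) * l e := by
    have h : l₁ - l₂ = -(l.comp (T ^ (n + 1) - T ^ n)) := by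
      rw [ContinuousLinearMap.comp_sub, neg_sub]
    rw [h, norm_neg, mul_comm]
    exact (l.opNorm_comp_le _).trans (mul_le_mul (hnorm_le l hl) hn (norm_nonneg _) hle)
  have hw : 0 ≤ (l₁ e + l₂ e - ‖l₁ - l₂‖) / 2 := by
    have := norm_sub_le l₁ l₂
    linarith [hnorm_le l₁ hp₁, hnorm_le l₂ hp₂]
  obtain ⟨u, hu, hu₁, hu₂, hue⟩ := exists_common_minorant he hp₁ hp₂
    (c := min ((l₁ e + l₂ e - ‖l₁ - l₂‖) / 2) (δ * l e)) (le_min hw (by positivity))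
    (by linarith [min_le_left ((l₁ e + l₂ e - ‖l₁ - l₂‖) / 2) (δ * l e)])
  have hshift : ∀ f, l₁ (T f) = l₂ f := fun f => by
    rw [hl₁, hl₂, pow_succ]
    rfl
  have hS : ∀ f, u (halfAverage T f) = (u f + u (T f)) / 2 := fun f => by
    rw [halfAverage_apply, map_smul, map_add, smul_eq_mul]
    ring
  refine ⟨u, l₂ - u.comp (halfAverage T), hu, fun f hf => ?_, by abel, ?_, ?_⟩
  · have h1 := hu₂ f hf
    have h2 := hu₁ (T f) (hTpos f hf)
    rw [hshift] at h2
    simp only [sub_apply, ContinuousLinearMap.comp_apply, hS]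
    linarith
  · rw [hue]
    exact min_le_right _ _
  · have h := hu₁ (e - T e) (sub_nonneg.2 (he.apply_le hT))
    rw [map_sub, map_sub, hshift] at h
    simp only [sub_apply, ContinuousLinearMap.comp_apply, hS]
    rcases min_choice ((l₁ e + l₂ e - ‖l₁ - l₂‖) / 2) (δ * l e) with h' | h' <;>
      rw [h'] at hue <;> nlinarith

theorem exists_decomp_pow (he : IsNormUnit e) (hTpos : IsPosOp T) (hT : ‖T‖ ≤ 1) {n : ℕ} {δ : ℝ}
    (hδ : 0 ≤ δ) (hn : ‖T ^ (n + 1) - T ^ n‖ ≤ 2 - 4 * δ) {l : E →L[ℝ] ℝ} (hl : IsPos l)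
    (k : ℕ) :
    ∃ a r : E →L[ℝ] ℝ, IsPos a ∧ IsPos r ∧
      l.comp (T ^ ((n + 1) * k)) = a.comp (halfAverage T) + r ∧
      a e ≤ (1 - (1 - δ) ^ k) * l e ∧ r e ≤ (1 - δ) ^ k * l e := by
  have hδ1 : δ ≤ 1 := by linarith [(norm_nonneg _).trans hn]
  induction k with
  | zero =>
    refine ⟨0, l, fun f _ => le_rfl, hl, ?_, by simp, by simp⟩
    ext f
    simp
  | succ k ih =>
    obtain ⟨a, r, ha, hr, hdec, hae, hre⟩ := ih
    obtain ⟨a', r', ha', hr', hdec', hae', hre'⟩ := exists_decomp he hTpos hT hδ hn hr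
    refine ⟨a.comp (T ^ (n + 1)) + a', r', fun f hf => add_nonneg
      (ha.comp (hTpos.pow _) f hf) (ha' f hf), hr', ?_, ?_, ?_⟩
    · ext f
      have h1 := DFunLike.congr_fun hdec ((T ^ (n + 1)) f)
      have h2 := DFunLike.congr_fun hdec' f
      have h3 := DFunLike.congr_fun ((commute_halfAverage T).pow_left (n + 1)).eq f
      rw [mul_add_one, pow_add]
      simp only [add_apply, ContinuousLinearMap.comp_apply,
        mul_apply_eq_comp] at h1 h2 h3 ⊢
      rw [h1, h2, h3, add_assoc]
    · have h1 : a ((T ^ (n + 1)) e) ≤ a e := ha.mono (he.apply_le (norm_pow_le_one hT _))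
      have h2 : δ * r e ≤ δ * ((1 - δ) ^ k * l e) := mul_le_mul_of_nonneg_left hre hδ
      simp only [add_apply, ContinuousLinearMap.comp_apply]
      rw [pow_succ (1 - δ)]
      linarith
    · rw [pow_succ', mul_assoc]
      exact hre'.trans (mul_le_mul_of_nonneg_left hre (by linarith))

theorem exists_decomp_halfAverage_pow (he : IsNormUnit e) (hTpos : IsPosOp T) (hT : ‖T‖ ≤ 1)
    {n : ℕ} {δ : ℝ} (hδ : 0 < δ) (hn : ‖T ^ (n + 1) - T ^ n‖ ≤ 2 - 4 * δ) (m : ℕ) :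
    ∀ ε : ℝ, 0 < ε → ∃ M : ℕ, ∀ l : E →L[ℝ] ℝ, IsPos l → ∃ a r : E →L[ℝ] ℝ, IsPos a ∧ IsPos r ∧
      l.comp (T ^ M) = a.comp (halfAverage T ^ m) + r ∧ a e ≤ l e ∧ r e ≤ ε * l e := by
  have hδ1 : δ ≤ 1 := by linarith [(norm_nonneg _).trans hn]
  induction m with
  | zero =>
    intro ε hε
    refine ⟨0, fun l hl => ⟨l, 0, hl, fun f _ => le_rfl, by simp, le_rfl, ?_⟩⟩
    exact mul_nonneg hε.le (hl e he.nonneg)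
  | succ m ih =>
    intro ε hε
    obtain ⟨M, hM⟩ := ih (ε / 2) (half_pos hε)
    obtain ⟨k, hk⟩ := exists_pow_lt_of_lt_one (half_pos hε) (by linarith : 1 - δ < 1)
    refine ⟨M + (n + 1) * k, fun l hl => ?_⟩
    obtain ⟨a, r, ha, hr, hdec, hae, hre⟩ := hM l hl
    obtain ⟨a', r', ha', hr', hdec', hae', hre'⟩ := exists_decomp_pow he hTpos hT hδ.le hn ha k
    have hle : 0 ≤ l e := hl e he.nonneg
    have hae0 : 0 ≤ a e := ha e he.nonneg
    have hpow : 0 ≤ (1 - δ) ^ k := pow_nonneg (by linarith) k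
    refine ⟨a', r'.comp (halfAverage T ^ m) + r.comp (T ^ ((n + 1) * k)), ha',
      fun f hf => add_nonneg (hr'.comp (hTpos.halfAverage.pow m) f hf)
        (hr.comp (hTpos.pow _) f hf), ?_, ?_, ?_⟩
    · ext f
      have h1 := DFunLike.congr_fun hdec ((T ^ ((n + 1) * k)) f)
      have h2 := DFunLike.congr_fun hdec' ((halfAverage T ^ m) f)
      have h3 := DFunLike.congr_fun ((commute_halfAverage T).pow_pow ((n + 1) * k) m).eq f
      rw [pow_add, pow_succ']
      simp only [add_apply, ContinuousLinearMap.comp_apply,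
        mul_apply_eq_comp] at h1 h2 h3 ⊢
      rw [h1, ← h3, h2, add_assoc]
    · nlinarith
    · have h1 : r' ((halfAverage T ^ m) e) ≤ r' e :=
        hr'.mono (he.apply_le (norm_pow_le_one (norm_halfAverage_le hT) m))
      have h2 : r ((T ^ ((n + 1) * k)) e) ≤ r e := hr.mono (he.apply_le (norm_pow_le_one hT _))
      have h3 : (1 - δ) ^ k * a e ≤ ε / 2 * l e := mul_le_mul hk.le hae hae0 (half_pos hε).le
      simp only [add_apply, ContinuousLinearMap.comp_apply]
      linarith

/-- The zero-two law for positive contractions of a normed lattice whose unit ball is an order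
interval. -/
theorem tendsto_norm_pow_succ_sub_pow (he : IsNormUnit e) (hTpos : IsPosOp T) (hT : ‖T‖ ≤ 1)
    {n : ℕ} (hn : ‖T ^ (n + 1) - T ^ n‖ < 2) :
    Tendsto (fun n : ℕ => ‖T ^ (n + 1) - T ^ n‖) atTop (nhds 0) := by
  have hδ : 0 < (2 - ‖T ^ (n + 1) - T ^ n‖) / 4 := by linarith
  have key : ∀ ε : ℝ, 0 < ε → ∃ M : ℕ, ‖T ^ (M + 1) - T ^ M‖ ≤ ε := by
    intro ε hε
    obtain ⟨r, hr⟩ := (tendsto_centralBinom_div_four_pow.eventually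
      (gt_mem_nhds (by positivity : (0 : ℝ) < ε / 4))).exists
    obtain ⟨M, hM⟩ := exists_decomp_halfAverage_pow he hTpos hT hδ (n := n) (by linarith)
      (2 * r) (ε / 4) (by positivity)
    have hS := norm_halfAverage_pow_mul_le hT r
    have hT1 : ‖1 - T‖ ≤ 2 := by
      have h1 : ‖(1 : E →L[ℝ] E)‖ ≤ 1 := ContinuousLinearMap.norm_id_le
      linarith [norm_sub_le 1 T]
    refine ⟨M, ContinuousLinearMap.opNorm_le_bound _ hε.le fun f => ?_⟩
    refine norm_le_of_forall_isPos he (by positivity) fun l hl hle => ?_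
    obtain ⟨a, s, ha, hs, hdec, hae, hse⟩ := hM l hl
    have hle0 : 0 ≤ l e := hl e he.nonneg
    have h1 := DFunLike.congr_fun hdec ((1 - T) f)
    have h2 : (T ^ (M + 1) - T ^ M) f = -((T ^ M) ((1 - T) f)) := by
      rw [pow_succ]
      simp
    have h3 : |a ((halfAverage T ^ (2 * r)) ((1 - T) f))| ≤ 1 * (ε / 2 * ‖f‖) := by
      refine (ha.le_norm_mul he _).trans (mul_le_mul (hae.trans hle) ?_ (norm_nonneg _) zero_le_one)
      refine ((halfAverage T ^ (2 * r) * (1 - T)).le_opNorm f).trans ?_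
      gcongr
      linarith
    have h4 : |s ((1 - T) f)| ≤ ε / 4 * (2 * ‖f‖) := by
      refine (hs.le_norm_mul he _).trans (mul_le_mul ?_ ?_ (norm_nonneg _) (by positivity))
      · exact hse.trans (mul_le_of_le_one_right (by positivity) hle)
      · exact ((1 - T).le_opNorm f).trans (by gcongr)
    simp only [add_apply, ContinuousLinearMap.comp_apply] at h1
    rw [h2, map_neg, abs_neg, h1]
    refine (abs_add_le _ _).trans ?_
    linarith
  rw [Metric.tendsto_atTop]
  intro ε hε
  obtain ⟨M, hM⟩ := key (ε / 2) (half_pos hε)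
  refine ⟨M, fun k hk => ?_⟩
  rw [Real.dist_eq, sub_zero, abs_of_nonneg (norm_nonneg _)]
  linarith [antitone_norm_pow_succ_sub_pow hT hk]

end OrderUnit

section Linfty

variable {Ω : Type*} [MeasurableSpace Ω] {μ : Measure Ω}

theorem posSMulMono_Linfty : PosSMulMono ℝ (Lp ℝ ∞ μ) := by
  refine ⟨fun t ht f g hfg => ?_⟩
  rw [← Lp.coeFn_le] at hfg ⊢
  filter_upwards [hfg, Lp.coeFn_smul t f, Lp.coeFn_smul t g] with x h h1 h2
  rw [h1, h2]
  exact mul_le_mul_of_nonneg_left h ht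

theorem isNormUnit_one_Linfty :
    IsNormUnit ((memLp_top_const (1 : ℝ)).toLp (fun _ => (1 : ℝ)) : Lp ℝ ∞ μ) where
  nonneg := by
    rw [← Lp.coeFn_nonneg]
    filter_upwards [(memLp_top_const (μ := μ) (1 : ℝ)).coeFn_toLp] with x hx
    rw [hx]
    exact zero_le_one
  norm_le := by
    rw [Lp.norm_toLp, eLpNorm_exponent_top]
    refine ENNReal.toReal_le_of_le_ofReal zero_le_one ?_
    exact eLpNormEssSup_le_of_ae_bound (Eventually.of_forall fun _ => by simp)
  le_norm_smul f := by
    rw [← Lp.coeFn_le]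
    filter_upwards [(memLp_top_const (μ := μ) (1 : ℝ)).coeFn_toLp,
      Lp.coeFn_smul ‖f‖ ((memLp_top_const (μ := μ) (1 : ℝ)).toLp (fun _ => (1 : ℝ))),
      ae_le_eLpNormEssSup (f := f) (μ := μ)] with x h1 h2 h3
    rw [h2, Pi.smul_apply, h1, smul_eq_mul, mul_one, Lp.norm_def, eLpNorm_exponent_top]
    refine (Real.le_norm_self _).trans ?_
    rw [← toReal_enorm]
    exact ENNReal.toReal_mono (by simpa using Lp.eLpNorm_ne_top f) h3

end Linfty

end ZeroTwoLaw

/-- Foguel's extension of the "zero-two" law to `L^∞`: for a positive linear contraction `T`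
on `L^∞(μ)` of a σ-finite measure space, either `‖T^{n+1} - T^n‖ = 2` for every `n`, or
`‖T^{n+1} - T^n‖ → 0`. -/
theorem zero_two_law_Linfty {Ω : Type*} [MeasurableSpace Ω] (μ : Measure Ω) [SigmaFinite μ]
    (T : Lp ℝ ∞ μ →L[ℝ] Lp ℝ ∞ μ)
    (hTpos : ∀ f : Lp ℝ ∞ μ, 0 ≤ f → 0 ≤ T f) (hT : ‖T‖ ≤ 1) :
    (∀ n : ℕ, ‖T ^ (n + 1) - T ^ n‖ = 2) ∨
      Tendsto (fun n : ℕ => ‖T ^ (n + 1) - T ^ n‖) atTop (nhds 0) := by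
  have := ZeroTwoLaw.posSMulMono_Linfty (μ := μ)
  by_cases h : ∀ n : ℕ, ‖T ^ (n + 1) - T ^ n‖ = 2
  · exact Or.inl h
  · obtain ⟨n, hn⟩ := not_forall.1 h
    have hle : ‖T ^ (n + 1) - T ^ n‖ ≤ 2 := by
      have := norm_sub_le (T ^ (n + 1)) (T ^ n)
      linarith [ZeroTwoLaw.norm_pow_le_one hT n, ZeroTwoLaw.norm_pow_le_one hT (n + 1)]
    exact Or.inr (ZeroTwoLaw.tendsto_norm_pow_succ_sub_pow ZeroTwoLaw.isNormUnit_one_Linfty hTpos hT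
      (lt_of_le_of_ne hle hn))
end

section
/- Let (Ω, Σ, μ) be a σ-finite measure space, let 1 < p < ∞ with p ≠ 2, and let T : L^p(μ) → L^p(μ) be a positive linear contraction. Suppose that for some m ∈ ℕ ∪ {0} there exists a positive bounded linear operator D : L^p(μ) → L^p(μ) which is the modulus of T^{m+1} − T^m and satisfies ‖D‖ < 2. Then lim_{n→∞} ‖T^{n+1} − T^n‖ = 0. -/
open scoped ENNReal
open MeasureTheory Filter

section PowerBounded

variable {A : Type*} [NormedRing A]

theorem Polynomial.smul_one_sub_X_mul_one_add_X_pow (n : ℕ) :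
    ((n : ℝ) + 1) • ((1 - Polynomial.X) * (1 + Polynomial.X) ^ n : Polynomial ℝ) =
      ∑ i ∈ Finset.range (n + 2),
        ((n + 1).choose i * ((n : ℝ) + 1 - 2 * i)) • (Polynomial.X : Polynomial ℝ) ^ i := by
  have h₁ : (1 + Polynomial.X : Polynomial ℝ) ^ (n + 1) =
      ∑ i ∈ Finset.range (n + 2), ((n + 1).choose i : ℝ) • (Polynomial.X : Polynomial ℝ) ^ i := by
    rw [add_comm, add_pow]
    refine Finset.sum_congr rfl fun i _ => ?_
    rw [one_pow, mul_one, mul_comm, Polynomial.smul_eq_C_mul]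
    simp
  have h₂ : Polynomial.X * (((n : ℝ) + 1) • (1 + Polynomial.X : Polynomial ℝ) ^ n) =
      ∑ i ∈ Finset.range (n + 2),
        ((n + 1).choose i * (i : ℝ)) • (Polynomial.X : Polynomial ℝ) ^ i := by
    have h := congrArg (fun q : Polynomial ℝ => Polynomial.X * Polynomial.derivative q) h₁
    simp only [Polynomial.derivative_sum, Finset.mul_sum] at h
    convert! h using 1
    · simp [Polynomial.derivative_pow, Polynomial.smul_eq_C_mul]
    · refine Finset.sum_congr rfl fun i _ => ?_
      rcases i with _ | i
      · simp
      · simp [Polynomial.derivative_pow, Polynomial.smul_eq_C_mul]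
        ring
  have h₃ : ((n : ℝ) + 1) • ((1 - Polynomial.X) * (1 + Polynomial.X) ^ n : Polynomial ℝ) =
      ((n : ℝ) + 1) • (1 + Polynomial.X : Polynomial ℝ) ^ (n + 1) -
        (2 : ℝ) • (Polynomial.X * (((n : ℝ) + 1) • (1 + Polynomial.X : Polynomial ℝ) ^ n)) := by
    simp only [Polynomial.smul_eq_C_mul, map_ofNat]
    ring
  rw [h₃, h₁, h₂, Finset.smul_sum, Finset.smul_sum, ← Finset.sum_sub_distrib]
  refine Finset.sum_congr rfl fun i _ => ?_
  rw [smul_smul, smul_smul, ← sub_smul]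
  congr 1
  ring

theorem sum_choose_mul_sq_sub_two_mul (n : ℕ) :
    ∑ i ∈ Finset.range (n + 1), (n.choose i : ℝ) * ((n : ℝ) - 2 * i) ^ 2 = 2 ^ n * (n : ℝ) := by
  have h := congrArg (Polynomial.eval (1 / 2 : ℝ)) (bernsteinPolynomial.variance ℝ n)
  simp only [Polynomial.eval_finsetSum, bernsteinPolynomial, Polynomial.eval_mul,
    Polynomial.eval_pow, Polynomial.eval_sub, Polynomial.eval_X,
    Polynomial.eval_natCast, Polynomial.eval_one, nsmul_eq_mul] at h
  have h' : ∑ i ∈ Finset.range (n + 1), (n.choose i : ℝ) * ((n : ℝ) - 2 * i) ^ 2 =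
      (2 ^ n * 4) * ∑ i ∈ Finset.range (n + 1),
        ((n : ℝ) * (1 / 2) - i) ^ 2 * (n.choose i * (1 / 2) ^ i * (1 - 1 / 2) ^ (n - i)) := by
    rw [Finset.mul_sum]
    refine Finset.sum_congr rfl fun i hi => ?_
    have hpow : (1 / 2 : ℝ) ^ i * (1 - 1 / 2) ^ (n - i) = (2 ^ n)⁻¹ := by
      rw [show (1 - 1 / 2 : ℝ) = 1 / 2 by norm_num, ← pow_add,
        Nat.add_sub_cancel' (Nat.lt_succ_iff.mp (Finset.mem_range.mp hi))]
      simp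
    rw [mul_assoc (n.choose i : ℝ), hpow]
    field_simp
    ring
  rw [h', h]
  ring

theorem sum_choose_mul_abs_sub_two_mul_le (n : ℕ) (hn : 0 < n) :
    ∑ i ∈ Finset.range (n + 1), (n.choose i : ℝ) * |(n : ℝ) - 2 * i| ≤ 2 ^ n * √n := by
  have hs : 0 < √(n : ℝ) := by positivity
  have hss : √(n : ℝ) * √n = n := Real.mul_self_sqrt (by positivity)
  have hpt : ∀ x : ℝ, |x| ≤ x ^ 2 / (2 * √n) + √n / 2 := by
    intro x
    rw [← sub_nonneg]
    have : x ^ 2 / (2 * √n) + √n / 2 - |x| = (|x| - √n) ^ 2 / (2 * √n) := by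
      field_simp
      rw [sub_sq, sq_abs]
      ring
    rw [this]
    positivity
  calc ∑ i ∈ Finset.range (n + 1), (n.choose i : ℝ) * |(n : ℝ) - 2 * i|
      ≤ ∑ i ∈ Finset.range (n + 1),
          (n.choose i : ℝ) * (((n : ℝ) - 2 * i) ^ 2 / (2 * √n) + √n / 2) := by
        gcongr with i _
        exact hpt _
    _ = (∑ i ∈ Finset.range (n + 1), (n.choose i : ℝ) * ((n : ℝ) - 2 * i) ^ 2) / (2 * √n) +
          (∑ i ∈ Finset.range (n + 1), (n.choose i : ℝ)) * (√n / 2) := by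
        rw [Finset.sum_div, Finset.sum_mul, ← Finset.sum_add_distrib]
        refine Finset.sum_congr rfl fun i _ => ?_
        ring
    _ = 2 ^ n * √n := by
        rw [sum_choose_mul_sq_sub_two_mul, ← Nat.cast_sum, Nat.sum_range_choose]
        push_cast
        field_simp
        nlinarith

theorem norm_one_sub_mul_half_one_add_pow_le [NormedAlgebra ℝ A] {T : A}
    (hT : ∀ n, ‖T ^ n‖ ≤ 1) (n : ℕ) :
    ‖(1 - T) * ((1 / 2 : ℝ) • (1 + T)) ^ n‖ ≤ 2 / √((n : ℝ) + 1) := by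
  have h := congrArg (Polynomial.aeval T) (Polynomial.smul_one_sub_X_mul_one_add_X_pow n)
  simp only [map_smul, map_mul, map_sub, map_one, Polynomial.aeval_X, map_pow, map_add,
    map_sum] at h
  have hn : (0 : ℝ) < n + 1 := by positivity
  have hb : ((n : ℝ) + 1) * ‖(1 - T) * (1 + T) ^ n‖ ≤ 2 ^ (n + 1) * √((n : ℝ) + 1) := by
    calc ((n : ℝ) + 1) * ‖(1 - T) * (1 + T) ^ n‖
        = ‖((n : ℝ) + 1) • ((1 - T) * (1 + T) ^ n)‖ := by
          rw [norm_smul, Real.norm_of_nonneg hn.le]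
      _ ≤ ∑ i ∈ Finset.range (n + 2), ((n + 1).choose i : ℝ) * |(n : ℝ) + 1 - 2 * i| := by
          rw [h]
          refine (norm_sum_le _ _).trans (Finset.sum_le_sum fun i _ => ?_)
          rw [norm_smul, norm_mul, Real.norm_natCast, Real.norm_eq_abs]
          exact mul_le_of_le_one_right (by positivity) (hT i)
      _ ≤ 2 ^ (n + 1) * √((n : ℝ) + 1) := by
          simpa using sum_choose_mul_abs_sub_two_mul_le (n + 1) n.succ_pos
  rw [smul_pow, mul_smul_comm, norm_smul, Real.norm_of_nonneg (by positivity)]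
  have hs : 0 < √((n : ℝ) + 1) := by positivity
  have hss : √((n : ℝ) + 1) * √((n : ℝ) + 1) = n + 1 := Real.mul_self_sqrt hn.le
  rw [le_div_iff₀ hs]
  have hb' : √((n : ℝ) + 1) * ‖(1 - T) * (1 + T) ^ n‖ ≤ 2 ^ (n + 1) := by
    refine le_of_mul_le_mul_right ?_ hs
    calc _ = (√((n : ℝ) + 1) * √((n : ℝ) + 1)) * ‖(1 - T) * (1 + T) ^ n‖ := by ring
      _ ≤ _ := by rw [hss]; exact hb
  calc (1 / 2 : ℝ) ^ n * ‖(1 - T) * (1 + T) ^ n‖ * √((n : ℝ) + 1)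
      = (1 / 2 : ℝ) ^ n * (√((n : ℝ) + 1) * ‖(1 - T) * (1 + T) ^ n‖) := by ring
    _ ≤ (1 / 2 : ℝ) ^ n * 2 ^ (n + 1) := by gcongr
    _ = 2 := by rw [pow_succ, ← mul_assoc, ← mul_pow]; norm_num

theorem exists_norm_pow_mul_one_sub_pow_le_of_succ [NormedAlgebra ℝ A] {T : A}
    (hT : ∀ n, ‖T ^ n‖ ≤ 1) {q : ℕ}
    (h : ∀ ε > 0, ∃ N, ‖T ^ N * (1 - T) ^ (q + 2)‖ ≤ ε) (ε : ℝ) (hε : 0 < ε) :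
    ∃ N, ‖T ^ N * (1 - T) ^ (q + 1)‖ ≤ ε := by
  set C : ℝ := 2 * ‖(1 - T) ^ q‖ with hC
  obtain ⟨L, hL⟩ := exists_nat_gt (2 * C / ε)
  have hC0 : 0 ≤ C := by positivity
  have hL0 : (0 : ℝ) < L := lt_of_le_of_lt (by positivity) hL
  obtain ⟨N, hN⟩ := h (ε / (2 * L)) (by positivity)
  refine ⟨N, ?_⟩
  set x := T ^ N * (1 - T) ^ (q + 1) with hx
  have hcomm : ∀ a b : ℕ, T ^ a * (1 - T) ^ b = (1 - T) ^ b * T ^ a := fun a b =>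
    (((Commute.one_right T).sub_right (Commute.refl T)).pow_pow a b).eq
  have hsplit : (L : ℝ) • x =
      ∑ i ∈ Finset.range L, (1 - T ^ i) * x + (∑ i ∈ Finset.range L, T ^ i) * x := by
    rw [Finset.sum_mul, ← Finset.sum_add_distrib, Finset.sum_congr rfl
      (g := fun _ => x) fun i _ => by rw [sub_mul, one_mul, sub_add_cancel]]
    simp [Nat.cast_smul_eq_nsmul]
  have hfirst : ∀ i ∈ Finset.range L, ‖(1 - T ^ i) * x‖ ≤ L * (ε / (2 * L)) := by
    intro i hi
    have heq : (1 - T ^ i) * x = (∑ l ∈ Finset.range i, T ^ l) * (T ^ N * (1 - T) ^ (q + 2)) := by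
      rw [← geom_sum_mul_neg, hx, hcomm, hcomm, mul_assoc, ← mul_assoc (1 - T), ← pow_succ']
    rw [heq]
    refine (norm_mul_le _ _).trans (mul_le_mul ?_ hN (norm_nonneg _) hL0.le)
    calc ‖∑ l ∈ Finset.range i, T ^ l‖ ≤ ∑ l ∈ Finset.range i, (1 : ℝ) :=
          norm_sum_le_of_le _ fun l _ => hT l
      _ ≤ L := by simpa using (Finset.mem_range.mp hi).le
  have hsecond : ‖(∑ i ∈ Finset.range L, T ^ i) * x‖ ≤ C := by
    have heq : (∑ i ∈ Finset.range L, T ^ i) * x = (T ^ N - T ^ (L + N)) * (1 - T) ^ q := by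
      rw [hx, hcomm, pow_succ', mul_assoc, ← mul_assoc, geom_sum_mul_neg, ← hcomm, ← mul_assoc,
        sub_mul, one_mul, pow_add]
    rw [heq]
    refine (norm_mul_le _ _).trans ?_
    rw [hC]
    gcongr
    calc _ ≤ ‖T ^ N‖ + ‖T ^ (L + N)‖ := norm_sub_le _ _
      _ ≤ 2 := by linarith [hT N, hT (L + N)]
  have htotal : L * ‖x‖ ≤ L * (L * (ε / (2 * L))) + C := by
    calc L * ‖x‖ = ‖(L : ℝ) • x‖ := by rw [norm_smul, Real.norm_natCast]
      _ ≤ _ := by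
        rw [hsplit]
        refine (norm_add_le _ _).trans (add_le_add ?_ hsecond)
        refine (norm_sum_le_of_le _ hfirst).trans ?_
        simp
  have hCL : 2 * C < L * ε := by rwa [div_lt_iff₀ hε] at hL
  have : (L : ℝ) * (ε / (2 * L)) = ε / 2 := by field_simp
  rw [this] at htotal
  refine le_of_mul_le_mul_left ?_ hL0
  nlinarith

end PowerBounded

section PositiveOperators

variable {E : Type*} [NormedAddCommGroup E] [NormedSpace ℝ E] [Lattice E]

/-- An operator on an ordered normed space is positive if it preserves nonnegativity. -/
def IsPositiveOperator (A : E →L[ℝ] E) : Prop :=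
  ∀ f, 0 ≤ f → 0 ≤ A f

namespace IsPositiveOperator

variable {A B : E →L[ℝ] E}

theorem one : IsPositiveOperator (1 : E →L[ℝ] E) := fun _ hf => hf

theorem zero : IsPositiveOperator (0 : E →L[ℝ] E) := fun _ _ => le_rfl

theorem mul (hA : IsPositiveOperator A) (hB : IsPositiveOperator B) :
    IsPositiveOperator (A * B) :=
  fun f hf => hA _ (hB f hf)

theorem pow (hA : IsPositiveOperator A) (n : ℕ) : IsPositiveOperator (A ^ n) := by
  induction n with
  | zero => simpa using one
  | succ n ih => rw [pow_succ]; exact ih.mul hA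

theorem smul [IsOrderedModule ℝ E] (hA : IsPositiveOperator A) {c : ℝ} (hc : 0 ≤ c) :
    IsPositiveOperator (c • A) :=
  fun f hf => smul_nonneg hc (hA f hf)

variable [IsOrderedAddMonoid E]

theorem add (hA : IsPositiveOperator A) (hB : IsPositiveOperator B) :
    IsPositiveOperator (A + B) :=
  fun f hf => add_nonneg (hA f hf) (hB f hf)

theorem sum {ι : Type*} {s : Finset ι} {F : ι → E →L[ℝ] E}
    (hF : ∀ i ∈ s, IsPositiveOperator (F i)) : IsPositiveOperator (∑ i ∈ s, F i) := by
  intro f hf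
  rw [sum_apply]
  exact Finset.sum_nonneg fun i hi => hF i hi f hf

theorem mono (hA : IsPositiveOperator A) {f g : E} (h : f ≤ g) : A f ≤ A g := by
  simpa using hA (g - f) (sub_nonneg.mpr h)

theorem abs_apply_le (hA : IsPositiveOperator A) (f : E) : |A f| ≤ A |f| :=
  abs_le'.mpr ⟨hA.mono (le_abs_self f), by
    rw [← map_neg]
    exact hA.mono (neg_le_abs f)⟩

theorem norm_le_norm [HasSolidNorm E] (hA : IsPositiveOperator A)
    (hAB : IsPositiveOperator (B - A)) : ‖A‖ ≤ ‖B‖ := by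
  refine A.opNorm_le_bound (norm_nonneg _) fun f => ?_
  have h : |A f| ≤ |B (|f|)| := by
    refine (hA.abs_apply_le f).trans (le_trans ?_ (le_abs_self _))
    simpa using hAB |f| (abs_nonneg f)
  calc ‖A f‖ ≤ ‖B |f|‖ := norm_le_norm_of_abs_le_abs h
    _ ≤ ‖B‖ * ‖f‖ := by
      rw [← norm_abs_eq_norm f]
      exact B.le_opNorm |f|

end IsPositiveOperator

variable [IsOrderedAddMonoid E]

theorem exists_pow_eq_mul_add_sum {T P S G G' : E →L[ℝ] E} {m : ℕ}
    (hT : IsPositiveOperator T) (hS : IsPositiveOperator S)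
    (hG : IsPositiveOperator G) (hG' : IsPositiveOperator G') (hPT : Commute P T)
    (hdec : T ^ m = P * S + (T * G + G')) (k : ℕ) :
    ∃ (V : E →L[ℝ] E) (F : ℕ → E →L[ℝ] E), IsPositiveOperator V ∧
      (∀ i, IsPositiveOperator (F i)) ∧ (∀ i, k < i → F i = 0) ∧
      ∑ i ∈ Finset.range (k + 1), F i = (G + G') ^ k ∧
      T ^ (m * k) = P * V + ∑ i ∈ Finset.range (k + 1), T ^ i * F i := by
  induction k with
  | zero =>
    refine ⟨0, fun i => if i = 0 then 1 else 0, .zero, fun i => ?_, fun i hi => if_neg hi.ne',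
      by simp, by simp⟩
    dsimp only
    split_ifs
    exacts [.one, .zero]
  | succ k ih =>
    obtain ⟨V, F, hV, hF, hF0, hsum, hpow⟩ := ih
    have hlast : F (k + 1) = 0 := hF0 _ k.lt_succ_self
    refine ⟨T ^ m * V + ∑ i ∈ Finset.range (k + 1), T ^ i * (S * F i),
      fun i => G' * F i + (match i with | 0 => 0 | j + 1 => G * F j),
      ((hT.pow m).mul hV).add (.sum fun i _ => (hT.pow i).mul (hS.mul (hF i))), ?_, ?_, ?_, ?_⟩
    · rintro (_ | j)
      · exact (hG'.mul (hF 0)).add .zero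
      · exact (hG'.mul (hF _)).add (hG.mul (hF j))
    · rintro (_ | j) hj
      · omega
      · simp [hF0 (j + 1) (by omega), hF0 j (by omega)]
    · rw [Finset.sum_add_distrib, Finset.sum_range_succ, Finset.sum_range_succ' (n := k + 1),
        hlast, ← Finset.mul_sum, ← Finset.mul_sum, hsum, pow_succ']
      simp [add_mul, add_comm]
    · have hterm : ∀ i, T ^ m * (T ^ i * F i) =
          P * (T ^ i * (S * F i)) + (T ^ i * (G' * F i) + T ^ (i + 1) * (G * F i)) := by
        intro i
        rw [← mul_assoc, (Commute.pow_pow_self T m i).eq, hdec, mul_assoc, add_mul, add_mul,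
          mul_add, mul_add, ← mul_assoc P, (hPT.pow_right i).eq, pow_succ]
        simp only [mul_assoc]
        abel
      have hPm : T ^ m * (P * V) = P * (T ^ m * V) := by
        rw [← mul_assoc, ← (hPT.pow_right m).eq, mul_assoc]
      rw [mul_add m k 1, mul_one, add_comm (m * k), pow_add, hpow, mul_add, hPm, Finset.mul_sum]
      simp only [hterm, mul_add, Finset.sum_add_distrib, ← Finset.mul_sum]
      rw [Finset.sum_range_succ (fun i => T ^ i * (G' * F i)) (k + 1),
        Finset.sum_range_succ' (n := k + 1), hlast]
      simp only [mul_zero, add_zero]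
      abel

variable [HasSolidNorm E]

theorem exists_pow_eq_mul_add_of_norm_lt_one {T P S G G' : E →L[ℝ] E} {m : ℕ}
    (hT : IsPositiveOperator T) (hT1 : ∀ n, ‖T ^ n‖ ≤ 1) (hS : IsPositiveOperator S)
    (hG : IsPositiveOperator G) (hG' : IsPositiveOperator G') (hPT : Commute P T)
    (hdec : T ^ m = P * S + (T * G + G')) (hGG' : ‖G + G'‖ < 1) {ε : ℝ} (hε : 0 < ε) :
    ∃ (K : ℕ) (V R : E →L[ℝ] E), IsPositiveOperator V ∧ IsPositiveOperator R ∧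
      T ^ K = P * V + R ∧ ‖R‖ ≤ ε := by
  have hlim : Tendsto (fun k : ℕ => ((k : ℝ) + 1) * ‖G + G'‖ ^ k) atTop (nhds 0) := by
    have h₁ := tendsto_self_mul_const_pow_of_lt_one (norm_nonneg (G + G')) hGG'
    have h₂ := tendsto_pow_atTop_nhds_zero_of_lt_one (norm_nonneg (G + G')) hGG'
    simpa [add_mul] using h₁.add h₂
  obtain ⟨k, hk, hk0⟩ := ((hlim.eventually (gt_mem_nhds hε)).and (eventually_gt_atTop 0)).exists
  obtain ⟨V, F, hV, hF, -, hsum, hpow⟩ := exists_pow_eq_mul_add_sum hT hS hG hG' hPT hdec k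
  refine ⟨m * k, V, _, hV, .sum fun i _ => (hT.pow i).mul (hF i), hpow, ?_⟩
  have hFnorm : ∀ i ∈ Finset.range (k + 1), ‖T ^ i * F i‖ ≤ ‖G + G'‖ ^ k := by
    intro i hi
    have hle : ‖F i‖ ≤ ‖(G + G') ^ k‖ := by
      refine (hF i).norm_le_norm ?_
      rw [← hsum, ← Finset.sum_erase_add _ _ hi, add_sub_cancel_right]
      exact .sum fun i _ => hF i
    calc ‖T ^ i * F i‖ ≤ ‖T ^ i‖ * ‖F i‖ := norm_mul_le _ _
      _ ≤ ‖F i‖ := mul_le_of_le_one_left (norm_nonneg _) (hT1 i)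
      _ ≤ ‖G + G'‖ ^ k := hle.trans (norm_pow_le' _ hk0)
  refine (norm_sum_le_of_le _ hFnorm).trans ?_
  simpa using hk.le

variable [IsOrderedModule ℝ E]

theorem exists_pow_eq_half_one_add_pow_mul_add {T : E →L[ℝ] E} (hT : IsPositiveOperator T)
    (hT1 : ∀ n, ‖T ^ n‖ ≤ 1)
    (h : ∀ ε > 0, ∃ (K : ℕ) (V R : E →L[ℝ] E), IsPositiveOperator V ∧ IsPositiveOperator R ∧
      T ^ K = (1 / 2 : ℝ) • (1 + T) * V + R ∧ ‖R‖ ≤ ε) (j : ℕ) {ε : ℝ} (hε : 0 < ε) :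
    ∃ (N : ℕ) (V R : E →L[ℝ] E), IsPositiveOperator V ∧ IsPositiveOperator R ∧
      T ^ N = ((1 / 2 : ℝ) • (1 + T)) ^ j * V + R ∧ ‖R‖ ≤ ε := by
  obtain ⟨K, V, R, hV, hR, hK, hRε⟩ := h (ε / 2 ^ j) (by positivity)
  set P : E →L[ℝ] E := (1 / 2 : ℝ) • (1 + T) with hP
  have hPpos : IsPositiveOperator P := (IsPositiveOperator.one.add hT).smul (by norm_num)
  have hPT : Commute P T :=
    ((Commute.one_left T).add_left (Commute.refl T)).smul_left _
  have hP1 : ‖P‖ ≤ 1 := by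
    have h0 := hT1 0
    have h1 := hT1 1
    rw [pow_zero] at h0
    rw [pow_one] at h1
    rw [hP, norm_smul, Real.norm_of_nonneg (by norm_num)]
    linarith [norm_add_le (1 : E →L[ℝ] E) T]
  have hPn : ∀ i, ‖P ^ i‖ ≤ 1 := by
    rintro (_ | i)
    · simpa using hT1 0
    · exact (norm_pow_le' _ i.succ_pos).trans (pow_le_one₀ (norm_nonneg _) hP1)
  have hV2 : ‖V‖ ≤ 2 := by
    have hle : ‖(1 / 2 : ℝ) • V‖ ≤ ‖T ^ K‖ := by
      refine (hV.smul (by norm_num)).norm_le_norm ?_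
      have : T ^ K - (1 / 2 : ℝ) • V = (1 / 2 : ℝ) • (T * V) + R := by
        rw [hK, hP, smul_mul_assoc, add_mul, one_mul, smul_add]
        abel
      rw [this]
      exact ((hT.mul hV).smul (by norm_num)).add hR
    rw [norm_smul, Real.norm_of_nonneg (by norm_num)] at hle
    linarith [hT1 K]
  have hVn : ∀ i, ‖V ^ i‖ ≤ 2 ^ i := by
    rintro (_ | i)
    · simpa using hT1 0
    · exact (norm_pow_le' _ i.succ_pos).trans (by gcongr)
  have hind : ∀ i : ℕ, ∃ R' : E →L[ℝ] E, IsPositiveOperator R' ∧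
      T ^ (K * i) = P ^ i * V ^ i + R' ∧ ‖R'‖ ≤ 2 ^ i * (ε / 2 ^ j) := by
    intro i
    induction i with
    | zero => exact ⟨0, .zero, by simp, by simp; positivity⟩
    | succ i ih =>
      obtain ⟨R', hR', hi, hR'ε⟩ := ih
      refine ⟨P ^ i * (R * V ^ i) + T ^ K * R',
        ((hPpos.pow i).mul (hR.mul (hV.pow i))).add ((hT.pow K).mul hR'), ?_, ?_⟩
      · have hcomm : T ^ K * (P ^ i * V ^ i) = P ^ i * (T ^ K * V ^ i) := by
          rw [← mul_assoc, ← (hPT.pow_pow i K).eq, mul_assoc]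
        rw [mul_add K i 1, mul_one, add_comm (K * i), pow_add, hi, mul_add, hcomm, hK]
        simp only [add_mul, mul_add, pow_succ P, pow_succ' V, mul_assoc]
        abel
      · have h₁ : ‖P ^ i * (R * V ^ i)‖ ≤ 1 * (ε / 2 ^ j * 2 ^ i) := by
          refine (norm_mul_le _ _).trans (mul_le_mul (hPn i) ?_ (norm_nonneg _) zero_le_one)
          exact (norm_mul_le _ _).trans
            (mul_le_mul hRε (hVn i) (norm_nonneg _) (by positivity))
        have h₂ : ‖T ^ K * R'‖ ≤ 1 * (2 ^ i * (ε / 2 ^ j)) :=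
          (norm_mul_le _ _).trans (mul_le_mul (hT1 K) hR'ε (norm_nonneg _) zero_le_one)
        refine (norm_add_le _ _).trans ((add_le_add h₁ h₂).trans_eq ?_)
        ring
  obtain ⟨R', hR', hj, hR'ε⟩ := hind j
  refine ⟨K * j, V ^ j, R', hV.pow j, hR', hj, hR'ε.trans_eq ?_⟩
  field_simp

theorem norm_pow_mul_le_of_half_one_add_pow_mul {T V R : E →L[ℝ] E} {N l : ℕ}
    (hT : IsPositiveOperator T) (hT1 : ∀ n, ‖T ^ n‖ ≤ 1) (hV : IsPositiveOperator V)
    (hR : IsPositiveOperator R) (hl : 0 < l)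
    (hN : T ^ N = ((1 / 2 : ℝ) • (1 + T)) ^ (2 * l) * V + R) : ‖T ^ l * V‖ ≤ 2 * l := by
  have hexp : ((1 / 2 : ℝ) • (1 + T)) ^ (2 * l) * V =
      ∑ i ∈ Finset.range (2 * l + 1),
        ((1 / 2 : ℝ) ^ (2 * l) * (2 * l).choose i) • (T ^ i * V) := by
    rw [smul_pow, add_comm, (Commute.one_right T).add_pow, smul_mul_assoc, Finset.sum_mul,
      Finset.smul_sum]
    refine Finset.sum_congr rfl fun i _ => ?_
    rw [one_pow, mul_one, mul_smul, Nat.cast_smul_eq_nsmul, nsmul_eq_mul, Nat.cast_comm, mul_assoc,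
      mul_assoc, Nat.cast_comm]
  have hpos : ∀ i, IsPositiveOperator
      (((1 / 2 : ℝ) ^ (2 * l) * (2 * l).choose i) • (T ^ i * V)) := fun i =>
    ((hT.pow i).mul hV).smul (by positivity)
  have hle : ‖((1 / 2 : ℝ) ^ (2 * l) * (2 * l).choose l) • (T ^ l * V)‖ ≤ ‖T ^ N‖ := by
    refine (hpos l).norm_le_norm ?_
    rw [hN, hexp, ← Finset.sum_erase_add _ _ (Finset.mem_range.mpr (by omega : l < 2 * l + 1)),
      add_right_comm, add_sub_cancel_right]
    exact (IsPositiveOperator.sum fun i _ => hpos i).add hR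
  rw [norm_smul, Real.norm_of_nonneg (by positivity)] at hle
  have hc : (4 : ℝ) ^ l ≤ 2 * l * (2 * l).choose l := by
    exact_mod_cast Nat.four_pow_le_two_mul_self_mul_centralBinom l hl
  have h4 : (1 / 2 : ℝ) ^ (2 * l) * 4 ^ l = 1 := by
    rw [pow_mul, ← mul_pow]
    norm_num
  calc ‖T ^ l * V‖ = (1 / 2 : ℝ) ^ (2 * l) * 4 ^ l * ‖T ^ l * V‖ := by rw [h4, one_mul]
    _ ≤ (1 / 2 : ℝ) ^ (2 * l) * (2 * l * (2 * l).choose l) * ‖T ^ l * V‖ := by gcongr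
    _ = 2 * l * ((1 / 2 : ℝ) ^ (2 * l) * (2 * l).choose l * ‖T ^ l * V‖) := by ring
    _ ≤ 2 * l * 1 := by gcongr; exact hle.trans (hT1 N)
    _ = 2 * l := mul_one _

theorem exists_norm_pow_mul_one_sub_cube_le {T : E →L[ℝ] E} (hT : IsPositiveOperator T)
    (hT1 : ∀ n, ‖T ^ n‖ ≤ 1)
    (h : ∀ ε > 0, ∃ (K : ℕ) (V R : E →L[ℝ] E), IsPositiveOperator V ∧ IsPositiveOperator R ∧
      T ^ K = (1 / 2 : ℝ) • (1 + T) * V + R ∧ ‖R‖ ≤ ε) (ε : ℝ) (hε : 0 < ε) :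
    ∃ N, ‖T ^ N * (1 - T) ^ 3‖ ≤ ε := by
  obtain ⟨n, hn⟩ := exists_nat_gt (96 / ε : ℝ)
  have hn0 : (0 : ℝ) < n := lt_of_le_of_lt (by positivity) hn
  have hn1 : 0 < n ^ 2 := by
    have : 0 < n := by exact_mod_cast hn0
    positivity
  obtain ⟨N, V, R, hV, hR, hN, hRε⟩ :=
    exists_pow_eq_half_one_add_pow_mul_add hT hT1 h (2 * (3 * n ^ 2)) (by positivity : 0 < ε / 16)
  have hTV := norm_pow_mul_le_of_half_one_add_pow_mul hT hT1 hV hR (by omega) hN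
  have hrate := norm_one_sub_mul_half_one_add_pow_le hT1 (2 * n ^ 2)
  set P : E →L[ℝ] E := (1 / 2 : ℝ) • (1 + T) with hP
  set l := 3 * n ^ 2 with hl
  have h1T : Commute (1 - T) T := (Commute.one_left T).sub_left (Commute.refl T)
  have hPT : Commute P T := ((Commute.one_left T).add_left (Commute.refl T)).smul_left _
  have h1P : Commute (1 - T) P := ((Commute.one_left P).sub_left hPT.symm)
  refine ⟨l + N, ?_⟩
  have hcube : (1 - T) ^ 3 * P ^ (2 * l) = ((1 - T) * P ^ (2 * n ^ 2)) ^ 3 := by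
    rw [(h1P.pow_right _).mul_pow, ← pow_mul]
    congr 2
    rw [hl]
    ring
  have heq : T ^ (l + N) * (1 - T) ^ 3 =
      ((1 - T) * P ^ (2 * n ^ 2)) ^ 3 * (T ^ l * V) + (1 - T) ^ 3 * (T ^ l * R) := by
    rw [← (h1T.pow_pow 3 (l + N)).eq, pow_add, hN, mul_add, mul_add, ← mul_assoc (T ^ l),
      ← (hPT.pow_pow (2 * l) l).eq, mul_assoc (P ^ (2 * l)), ← mul_assoc, hcube]
  have hrate' : ‖(1 - T) * P ^ (2 * n ^ 2)‖ ≤ 2 / n := by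
    refine hrate.trans ?_
    gcongr
    refine Real.le_sqrt_of_sq_le ?_
    push_cast
    nlinarith
  have hmain : ‖((1 - T) * P ^ (2 * n ^ 2)) ^ 3 * (T ^ l * V)‖ ≤ ε / 2 := by
    calc ‖((1 - T) * P ^ (2 * n ^ 2)) ^ 3 * (T ^ l * V)‖
        ≤ ‖((1 - T) * P ^ (2 * n ^ 2)) ^ 3‖ * ‖T ^ l * V‖ := norm_mul_le _ _
      _ ≤ (2 / n) ^ 3 * (2 * l) := by
          gcongr
          exact (norm_pow_le' _ three_pos).trans (by gcongr)
      _ = 48 / n := by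
          rw [hl]
          push_cast
          field_simp
          norm_num
      _ ≤ ε / 2 := by
          rw [div_lt_iff₀ hε] at hn
          rw [div_le_div_iff₀ hn0 two_pos]
          linarith
  have h2 : ‖1 - T‖ ≤ 2 := by
    have h0 := hT1 0
    have h1 := hT1 1
    rw [pow_zero] at h0
    rw [pow_one] at h1
    linarith [norm_sub_le (1 : E →L[ℝ] E) T]
  have herror : ‖(1 - T) ^ 3 * (T ^ l * R)‖ ≤ ε / 2 := by
    calc ‖(1 - T) ^ 3 * (T ^ l * R)‖ ≤ ‖(1 - T) ^ 3‖ * (‖T ^ l‖ * ‖R‖) :=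
          (norm_mul_le _ _).trans (by gcongr; exact norm_mul_le _ _)
      _ ≤ 2 ^ 3 * (1 * (ε / 16)) := by
          gcongr
          · exact (norm_pow_le' _ three_pos).trans (by gcongr)
          · exact hT1 l
      _ = ε / 2 := by ring
  rw [heq]
  linarith [norm_add_le (((1 - T) * P ^ (2 * n ^ 2)) ^ 3 * (T ^ l * V))
    ((1 - T) ^ 3 * (T ^ l * R))]

/-- The zero-two law in a normed lattice, with the modulus replaced by any operator `D`
lying between `|T ^ (m + 1) - T ^ m|` and `T ^ (m + 1) + T ^ m`. -/
theorem tendsto_norm_pow_succ_sub_pow_of_norm_lt_two {T D : E →L[ℝ] E}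
    (hT : IsPositiveOperator T) (hT1 : ‖T‖ ≤ 1) (m : ℕ)
    (hsub : IsPositiveOperator (D - (T ^ (m + 1) - T ^ m)))
    (hadd : IsPositiveOperator (D + (T ^ (m + 1) - T ^ m)))
    (hle : IsPositiveOperator (T ^ (m + 1) + T ^ m - D)) (hD : ‖D‖ < 2) :
    Tendsto (fun n : ℕ => ‖T ^ (n + 1) - T ^ n‖) atTop (nhds 0) := by
  have hTn : ∀ n, ‖T ^ n‖ ≤ 1 := by
    rintro (_ | n)
    · exact ContinuousLinearMap.norm_id_le
    · exact (norm_pow_le' _ n.succ_pos).trans (pow_le_one₀ (norm_nonneg _) hT1)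
  have hPT : Commute ((1 / 2 : ℝ) • (1 + T)) T :=
    ((Commute.one_left T).add_left (Commute.refl T)).smul_left _
  have hdec : T ^ (m + 1) = (1 / 2 : ℝ) • (1 + T) * ((1 / 2 : ℝ) • (T ^ (m + 1) + T ^ m - D)) +
      (T * ((1 / 4 : ℝ) • (D - (T ^ (m + 1) - T ^ m))) +
        (1 / 4 : ℝ) • (D + (T ^ (m + 1) - T ^ m))) := by
    simp only [smul_mul_assoc, mul_smul_comm, add_mul, mul_add, mul_sub, one_mul,
      pow_succ' T m]
    module
  have hnorm : ‖(1 / 4 : ℝ) • (D - (T ^ (m + 1) - T ^ m)) +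
      (1 / 4 : ℝ) • (D + (T ^ (m + 1) - T ^ m))‖ < 1 := by
    have : (1 / 4 : ℝ) • (D - (T ^ (m + 1) - T ^ m)) +
        (1 / 4 : ℝ) • (D + (T ^ (m + 1) - T ^ m)) = (1 / 2 : ℝ) • D := by module
    rw [this, norm_smul, Real.norm_of_nonneg (by norm_num)]
    linarith
  have h₃ := exists_norm_pow_mul_one_sub_cube_le hT hTn fun ε hε =>
    exists_pow_eq_mul_add_of_norm_lt_one hT hTn (hle.smul (by norm_num))
      (hsub.smul (by norm_num)) (hadd.smul (by norm_num)) hPT hdec hnorm hε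
  have h₁ := exists_norm_pow_mul_one_sub_pow_le_of_succ (q := 0) hTn
    (exists_norm_pow_mul_one_sub_pow_le_of_succ (q := 1) hTn h₃)
  rw [Metric.tendsto_atTop]
  intro ε hε
  obtain ⟨N, hN⟩ := h₁ (ε / 2) (half_pos hε)
  refine ⟨N, fun n hn => ?_⟩
  have heq : T ^ (n + 1) - T ^ n = -(T ^ (n - N) * (T ^ N * (1 - T) ^ (0 + 1))) := by
    rw [← mul_assoc, ← pow_add, Nat.sub_add_cancel hn, zero_add, pow_one, mul_sub, mul_one,
      ← pow_succ, neg_sub]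
  rw [Real.dist_0_eq_abs, abs_norm, heq, norm_neg]
  calc ‖T ^ (n - N) * (T ^ N * (1 - T) ^ (0 + 1))‖ ≤ 1 * (ε / 2) :=
        (norm_mul_le _ _).trans (mul_le_mul (hTn _) hN (norm_nonneg _) zero_le_one)
    _ < ε := by linarith

end PositiveOperators

theorem MeasureTheory.Lp.isOrderedModule_real {Ω : Type*} [MeasurableSpace Ω] (μ : Measure Ω)
    (p : ℝ≥0∞) [Fact (1 ≤ p)] : IsOrderedModule ℝ (Lp ℝ p μ) :=
  .of_smul_nonneg fun c hc f hf => by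
    rw [← Lp.coeFn_nonneg] at hf ⊢
    filter_upwards [hf, Lp.coeFn_smul c f] with x hx hcx
    rw [hcx]
    exact mul_nonneg hc hx

/-- Zaharopol's "zero-two" law: let `1 < p < ∞`, `p ≠ 2`, and let `T` be a positive linear
contraction on `L^p(μ)` of a σ-finite measure space. If for some `m ∈ ℕ ∪ {0}` the modulus
`D` of `T^{m+1} - T^m` exists and satisfies `‖D‖ < 2`, then `‖T^{n+1} - T^n‖ → 0`. -/
theorem zero_two_law_Lp {Ω : Type*} [MeasurableSpace Ω] (μ : Measure Ω) [SigmaFinite μ]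
    (p : ℝ≥0∞) [Fact (1 ≤ p)] (hp1 : 1 < p) (hp2 : p ≠ ∞) (hp3 : p ≠ 2)
    (T : Lp ℝ p μ →L[ℝ] Lp ℝ p μ)
    (hTpos : ∀ f : Lp ℝ p μ, 0 ≤ f → 0 ≤ T f) (hT : ‖T‖ ≤ 1)
    (m : ℕ) (D : Lp ℝ p μ →L[ℝ] Lp ℝ p μ)
    (hDpos : ∀ f : Lp ℝ p μ, 0 ≤ f → 0 ≤ D f)
    (hDmod : ∀ f : Lp ℝ p μ, 0 ≤ f →
      IsLUB {h : Lp ℝ p μ | ∃ g : Lp ℝ p μ, |g| ≤ f ∧ h = |(T ^ (m + 1) - T ^ m) g|} (D f))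
    (hD : ‖D‖ < 2) :
    Tendsto (fun n : ℕ => ‖T ^ (n + 1) - T ^ n‖) atTop (nhds 0) := by
  have := Lp.isOrderedModule_real μ p
  have hmem : ∀ f : Lp ℝ p μ, 0 ≤ f → |(T ^ (m + 1) - T ^ m) f| ≤ D f := fun f hf =>
    (hDmod f hf).1 ⟨f, (abs_of_nonneg hf).le, rfl⟩
  have hT' : IsPositiveOperator T := hTpos
  refine tendsto_norm_pow_succ_sub_pow_of_norm_lt_two hT' hT m (fun f hf => ?_) (fun f hf => ?_)
    (fun f hf => ?_) hD
  · exact sub_nonneg.mpr ((le_abs_self _).trans (hmem f hf))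
  · exact neg_le_iff_add_nonneg.mp ((neg_le_abs _).trans (hmem f hf))
  · refine sub_nonneg.mpr ((hDmod f hf).2 ?_)
    rintro _ ⟨g, hg, rfl⟩
    have hpow : ∀ n, |(T ^ n) g| ≤ (T ^ n) f := fun n =>
      ((hT'.pow n).abs_apply_le g).trans ((hT'.pow n).mono hg)
    change |(T ^ (m + 1)) g - (T ^ m) g| ≤ (T ^ (m + 1)) f + (T ^ m) f
    rw [abs_le', neg_sub, sub_eq_add_neg, sub_eq_add_neg, add_comm ((T ^ m) g)]
    exact ⟨add_le_add ((le_abs_self _).trans (hpow _)) ((neg_le_abs _).trans (hpow _)),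
      add_le_add ((neg_le_abs _).trans (hpow _)) ((le_abs_self _).trans (hpow _))⟩
end

section
/- Let (Ω, Σ, μ) be a σ-finite measure space and let T : L²(μ) → L²(μ) be a positive linear contraction. Suppose that for some m ∈ ℕ ∪ {0} there exists a positive bounded linear operator D : L²(μ) → L²(μ) which is the modulus of T^{m+1} − T^m and satisfies ‖D‖ < 2. Then lim_{n→∞} ‖T^{n+1} − T^n‖ = 0. -/
open MeasureTheory Filter

section Hilbert

variable {H : Type*} [NormedAddCommGroup H] [InnerProductSpace ℂ H]

/-- Parseval's identity for the discrete Fourier transform of a vector-valued sequence. -/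
lemma sum_norm_sq_sum_root_smul {N : ℕ} {ζ : ℂ} (hζ : IsPrimitiveRoot ζ N) (hN : N ≠ 0)
    (x : ℕ → H) :
    ∑ k ∈ Finset.range N, ‖∑ j ∈ Finset.range N, (ζ ^ k) ^ j • x j‖ ^ 2
      = N * ∑ j ∈ Finset.range N, ‖x j‖ ^ 2 := by
  have hnorm : ‖ζ‖ = 1 := hζ.norm'_eq_one hN
  have hζ0 : ζ ≠ 0 := hζ.ne_zero hN
  have hconj : (starRingEnd ℂ) ζ = ζ⁻¹ := by
    rw [Complex.inv_eq_conj hnorm]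
  have orth : ∀ i ∈ Finset.range N, ∀ j ∈ Finset.range N,
      ∑ k ∈ Finset.range N, (starRingEnd ℂ) ((ζ ^ k) ^ i) * (ζ ^ k) ^ j
        = if i = j then (N : ℂ) else 0 := by
    intro i hi j hj
    have hterm : ∀ k, (starRingEnd ℂ) ((ζ ^ k) ^ i) * (ζ ^ k) ^ j = ((ζ ^ i)⁻¹ * ζ ^ j) ^ k := by
      intro k
      rw [map_pow, map_pow, hconj, mul_pow]
      simp only [inv_pow]
      ring
    simp only [hterm]
    split_ifs with hij
    · subst hij
      simp [hζ0]
    · have hne : (ζ ^ i)⁻¹ * ζ ^ j ≠ 1 := by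
        intro h
        apply hij
        refine hζ.pow_inj (Finset.mem_range.1 hi) (Finset.mem_range.1 hj) ?_
        exact (inv_mul_eq_one₀ (pow_ne_zero _ hζ0)).1 h
      have hpow : ((ζ ^ i)⁻¹ * ζ ^ j) ^ N = 1 := by
        rw [mul_pow, inv_pow, ← pow_mul, ← pow_mul, mul_comm i, mul_comm j, pow_mul, pow_mul,
          hζ.pow_eq_one]
        simp
      rw [geom_sum_eq hne, hpow]
      simp
  have key : ((∑ k ∈ Finset.range N,
      ‖∑ j ∈ Finset.range N, (ζ ^ k) ^ j • x j‖ ^ 2 : ℝ) : ℂ)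
      = ((N * ∑ j ∈ Finset.range N, ‖x j‖ ^ 2 : ℝ) : ℂ) := by
    push_cast
    have expand : ∀ k, ((‖∑ j ∈ Finset.range N, (ζ ^ k) ^ j • x j‖ : ℂ)) ^ 2
        = ∑ i ∈ Finset.range N, ∑ j ∈ Finset.range N,
          ((starRingEnd ℂ) ((ζ ^ k) ^ i) * (ζ ^ k) ^ j) * inner ℂ (x i) (x j) := by
      intro k
      have := inner_self_eq_norm_sq_to_K (𝕜 := ℂ) (∑ j ∈ Finset.range N, (ζ ^ k) ^ j • x j)
      refine Eq.trans this.symm ?_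
      rw [sum_inner]
      refine Finset.sum_congr rfl fun i _ => ?_
      rw [inner_sum]
      refine Finset.sum_congr rfl fun j _ => ?_
      rw [inner_smul_left, inner_smul_right]
      ring
    simp only [expand]
    rw [Finset.sum_comm, Finset.mul_sum]
    refine Finset.sum_congr rfl fun i hi => ?_
    rw [Finset.sum_comm]
    simp only [← Finset.sum_mul]
    rw [Finset.sum_congr rfl fun j hj => by rw [orth i hi j hj]]
    rw [Finset.sum_eq_single i]
    · simp
    · intro j _ hji
      simp [Ne.symm hji]
    · exact fun h => absurd hi h
  exact_mod_cast key

lemma norm_pow_apply_le {S : H →L[ℂ] H} (hS : ‖S‖ ≤ 1) (n : ℕ) (x : H) : ‖(S ^ n) x‖ ≤ ‖x‖ := by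
  induction n with
  | zero => simp
  | succ n ih =>
    rw [pow_succ']
    exact ((S.le_of_opNorm_le hS _).trans_eq (one_mul _)).trans ih

/-- If `‖Sⁿ (S - 1)‖` stays away from zero, a Hilbert space contraction `S` has approximate
unimodular eigenvalues `ω⁻¹` away from `1`. -/
lemma exists_approx_eigenvector {S : H →L[ℂ] H} (hS : ‖S‖ ≤ 1) {c : ℝ} (hc : 0 < c)
    (h : ∀ n : ℕ, ∃ x : H, ‖x‖ ≤ 1 ∧ c ≤ ‖(S ^ n) (S x - x)‖) {ε : ℝ} (hε : 0 < ε) :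
    ∃ (ω : ℂ) (f : H), ‖ω‖ = 1 ∧ c / 2 ≤ ‖ω - 1‖ ∧ 0 < ‖f‖ ∧ ‖ω • S f - f‖ ≤ ε * ‖f‖ := by
  set K : ℝ := 2 / ε with hK
  have hKpos : 0 < K := by positivity
  obtain ⟨N, hN⟩ := exists_nat_gt ((8 * K ^ 2 + 8) / (c ^ 2 / 2))
  have hNpos : (0 : ℝ) < N := lt_of_le_of_lt (by positivity) hN
  have hN0 : N ≠ 0 := by rintro rfl; simp at hNpos
  rw [div_lt_iff₀ (by positivity)] at hN
  obtain ⟨x, hx1, hxc⟩ := h N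
  have hζ := Complex.isPrimitiveRoot_exp N hN0
  set ζ : ℂ := Complex.exp (2 * Real.pi * Complex.I / N)
  let f : ℂ → H := fun ω => ∑ j ∈ Finset.range N, ω ^ j • (S ^ j) x
  let g : ℂ → H := fun ω => ∑ j ∈ Finset.range N, ω ^ j • (S ^ j) (S x - x)
  have shift : ∀ ω : ℂ, ω ^ N = 1 → ω • S (f ω) - f ω = (S ^ N) x - x := by
    intro ω hω
    have : ω • S (f ω) = ∑ j ∈ Finset.range N, ω ^ (j + 1) • (S ^ (j + 1)) x := by
      simp only [f, map_sum, map_smul, Finset.smul_sum, smul_smul, pow_succ' S,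
        mul_apply_eq_comp, pow_succ' ω]
    rw [this]
    have := Finset.sum_range_sub (fun j => ω ^ j • (S ^ j) x) N
    simpa [f, hω] using this
  have hbound : ‖(S ^ N) x - x‖ ≤ 2 := by
    have h1 := norm_pow_apply_le hS N x
    have h2 := norm_sub_le ((S ^ N) x) x
    linarith
  have hg : ∀ ω : ℂ, g ω = S (f ω) - f ω := by
    intro ω
    have hcomm : ∀ j, (S ^ j) (S x) = S ((S ^ j) x) := fun j => by
      rw [← mul_apply_eq_comp, ← mul_apply_eq_comp, ← pow_succ, ← pow_succ']
    simp only [f, g, map_sub, map_sum, map_smul, smul_sub, Finset.sum_sub_distrib, hcomm]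
  have hgnorm : ∀ ω : ℂ, ‖ω‖ = 1 → ω ^ N = 1 → ‖g ω‖ ≤ ‖ω - 1‖ * ‖f ω‖ + 2 := by
    intro ω h1 hω
    have e : ω • g ω = ((S ^ N) x - x) - (ω - 1) • f ω := by
      rw [← shift ω hω, hg, smul_sub, sub_smul, one_smul]
      abel
    calc ‖g ω‖ = ‖ω • g ω‖ := by rw [norm_smul, h1, one_mul]
      _ ≤ ‖(S ^ N) x - x‖ + ‖(ω - 1) • f ω‖ := by rw [e]; exact norm_sub_le _ _
      _ ≤ ‖ω - 1‖ * ‖f ω‖ + 2 := by rw [norm_smul]; linarith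
  by_contra hcon
  push Not at hcon
  have hdich : ∀ ω : ℂ, ‖ω‖ = 1 → ω ^ N = 1 →
      ‖g ω‖ ^ 2 ≤ c ^ 2 / 2 * ‖f ω‖ ^ 2 + (8 * K ^ 2 + 8) := by
    intro ω h1 hω
    have hle := hgnorm ω h1 hω
    have hf0 := norm_nonneg (f ω)
    have hg0 := norm_nonneg (g ω)
    by_cases hfar : c / 2 ≤ ‖ω - 1‖
    · have hfK : ‖f ω‖ ≤ K := by
        by_contra! hlt
        have := hcon ω (f ω) h1 hfar (hKpos.trans hlt)
        rw [shift ω hω] at this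
        have h2 : ε * K = 2 := by rw [hK]; field_simp
        nlinarith
      have hω2 : ‖ω - 1‖ ≤ 2 := by
        have := norm_sub_le ω 1
        rw [h1, norm_one] at this
        linarith
      have : ‖g ω‖ ≤ 2 * K + 2 := by nlinarith [norm_nonneg (ω - 1)]
      nlinarith [sq_nonneg (K - 1), sq_nonneg (c * ‖f ω‖)]
    · have : ‖g ω‖ ≤ c / 2 * ‖f ω‖ + 2 := by nlinarith
      nlinarith [sq_nonneg (c / 2 * ‖f ω‖ - 2), sq_nonneg K]
  have hroot1 : ∀ k, ‖ζ ^ k‖ = 1 := fun k => by rw [norm_pow, hζ.norm'_eq_one hN0, one_pow]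
  have hrootN : ∀ k, (ζ ^ k) ^ N = 1 := fun k => by
    rw [← pow_mul, mul_comm, pow_mul, hζ.pow_eq_one, one_pow]
  have hsum := Finset.sum_le_sum fun k (_ : k ∈ Finset.range N) =>
    hdich (ζ ^ k) (hroot1 k) (hrootN k)
  have hPg : ∑ k ∈ Finset.range N, ‖g (ζ ^ k)‖ ^ 2 = _ := sum_norm_sq_sum_root_smul hζ hN0 _
  have hPf : ∑ k ∈ Finset.range N, ‖f (ζ ^ k)‖ ^ 2 = _ := sum_norm_sq_sum_root_smul hζ hN0 _
  rw [Finset.sum_add_distrib, ← Finset.mul_sum, hPg, hPf, Finset.sum_const, Finset.card_range,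
    nsmul_eq_mul] at hsum
  have hlow : N * c ^ 2 ≤ ∑ j ∈ Finset.range N, ‖(S ^ j) (S x - x)‖ ^ 2 := by
    have := Finset.card_nsmul_le_sum (Finset.range N) (fun j => ‖(S ^ j) (S x - x)‖ ^ 2) (c ^ 2) ?_
    · simpa using this
    · intro j hj
      have hjN : N = (N - j) + j := by have := Finset.mem_range.1 hj; omega
      have : ‖(S ^ N) (S x - x)‖ ≤ ‖(S ^ j) (S x - x)‖ := by
        conv_lhs => rw [hjN, pow_add]
        exact norm_pow_apply_le hS _ _
      exact pow_le_pow_left₀ hc.le (hxc.trans this) 2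
  have hup : ∑ j ∈ Finset.range N, ‖(S ^ j) x‖ ^ 2 ≤ N := by
    have := Finset.sum_le_card_nsmul (Finset.range N) (fun j => ‖(S ^ j) x‖ ^ 2) 1 ?_
    · simpa using this
    · intro j _
      exact pow_le_one₀ (norm_nonneg _) ((norm_pow_apply_le hS j x).trans hx1)
  have h1 := mul_le_mul_of_nonneg_left hlow hNpos.le
  have h2 := mul_le_mul_of_nonneg_left hup (by positivity : 0 ≤ c ^ 2 / 2 * N)
  have h3 : (N : ℝ) * (N * (c ^ 2 / 2)) ≤ N * (8 * K ^ 2 + 8) := by nlinarith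
  have h4 := le_of_mul_le_mul_left h3 hNpos
  linarith

end Hilbert

section Complexification

variable {Ω : Type*} [MeasurableSpace Ω] {μ : Measure Ω}

/-- The pointwise real part on `L²`. -/
noncomputable def reLp (μ : Measure Ω) : Lp ℂ 2 μ →L[ℝ] Lp ℝ 2 μ := Complex.reCLM.compLpL 2 μ

/-- The inclusion of real `L²` into complex `L²`. -/
noncomputable def ofRealLp (μ : Measure Ω) : Lp ℝ 2 μ →L[ℝ] Lp ℂ 2 μ :=
  Complex.ofRealCLM.compLpL 2 μ

lemma coeFn_reLp (f : Lp ℂ 2 μ) : reLp μ f =ᵐ[μ] fun x => (f x).re :=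
  Complex.reCLM.coeFn_compLpL f

lemma coeFn_ofRealLp (f : Lp ℝ 2 μ) : ofRealLp μ f =ᵐ[μ] fun x => (f x : ℂ) :=
  Complex.ofRealCLM.coeFn_compLpL f

lemma norm_ofRealLp (f : Lp ℝ 2 μ) : ‖ofRealLp μ f‖ = ‖f‖ := by
  apply le_antisymm <;> refine Lp.norm_le_norm_of_ae_le ?_ <;>
    filter_upwards [coeFn_ofRealLp f] with x hx <;> simp [hx]

lemma reLp_ofRealLp (f : Lp ℝ 2 μ) : reLp μ (ofRealLp μ f) = f := by
  apply Lp.ext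
  filter_upwards [coeFn_reLp (ofRealLp μ f), coeFn_ofRealLp f] with x h1 h2
  simp [h1, h2]

lemma coeFn_reLp_smul (c : ℂ) (f : Lp ℂ 2 μ) : reLp μ (c • f) =ᵐ[μ] fun x => (c * f x).re := by
  filter_upwards [coeFn_reLp (c • f), Lp.coeFn_smul c f] with x h1 h2
  simp [h1, h2]

lemma reLp_smul (c : ℂ) (f : Lp ℂ 2 μ) :
    reLp μ (c • f) = c.re • reLp μ f + c.im • reLp μ (Complex.I • f) := by
  apply Lp.ext
  filter_upwards [coeFn_reLp_smul c f, coeFn_reLp f, coeFn_reLp_smul Complex.I f,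
    Lp.coeFn_add (c.re • reLp μ f) (c.im • reLp μ (Complex.I • f)),
    Lp.coeFn_smul c.re (reLp μ f), Lp.coeFn_smul c.im (reLp μ (Complex.I • f))]
    with x h1 h2 h3 h4 h5 h6
  rw [h1, h4, Pi.add_apply, h5, h6, Pi.smul_apply, Pi.smul_apply, h2, h3]
  simp
  ring

lemma Lp_complex_ext {f g : Lp ℂ 2 μ} (hre : reLp μ f = reLp μ g)
    (him : reLp μ (Complex.I • f) = reLp μ (Complex.I • g)) : f = g := by
  apply Lp.ext
  filter_upwards [coeFn_reLp f, coeFn_reLp g, coeFn_reLp_smul Complex.I f,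
    coeFn_reLp_smul Complex.I g] with x h1 h2 h3 h4
  rw [hre] at h1
  rw [him] at h3
  apply Complex.ext
  · exact h1.symm.trans h2
  · have := h3.symm.trans h4
    simpa using this

lemma norm_sq_eq_integral_norm_sq {E : Type*} [NormedAddCommGroup E] [InnerProductSpace ℝ E]
    (f : Lp E 2 μ) : ‖f‖ ^ 2 = ∫ x, ‖f x‖ ^ 2 ∂μ := by
  rw [← real_inner_self_eq_norm_sq, L2.inner_def]
  simp only [real_inner_self_eq_norm_sq]

lemma norm_sq_eq_reLp (f : Lp ℂ 2 μ) :
    ‖f‖ ^ 2 = ‖reLp μ f‖ ^ 2 + ‖reLp μ (Complex.I • f)‖ ^ 2 := by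
  simp only [norm_sq_eq_integral_norm_sq]
  rw [← integral_add ((Lp.memLp _).integrable_norm_pow (by norm_num))
    ((Lp.memLp _).integrable_norm_pow (by norm_num))]
  refine integral_congr_ae ?_
  filter_upwards [coeFn_reLp f, coeFn_reLp_smul Complex.I f] with x h1 h2
  rw [h1, h2, Complex.sq_norm, Complex.normSq_apply]
  simp
  ring

lemma reLp_I_smul_ofRealLp (a : Lp ℝ 2 μ) : reLp μ (Complex.I • ofRealLp μ a) = 0 := by
  rw [Lp.eq_zero_iff_ae_eq_zero]
  filter_upwards [coeFn_reLp_smul Complex.I (ofRealLp μ a), coeFn_ofRealLp a] with x h1 h2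
  simp [h1, h2]

lemma reLp_I_smul_I_smul (f : Lp ℂ 2 μ) : reLp μ (Complex.I • Complex.I • f) = -reLp μ f := by
  rw [smul_smul, Complex.I_mul_I, neg_smul, one_smul, map_neg]

lemma reLp_ofRealLp_sub (a b : Lp ℝ 2 μ) :
    reLp μ (ofRealLp μ a - Complex.I • ofRealLp μ b) = a := by
  rw [map_sub, reLp_I_smul_ofRealLp, reLp_ofRealLp, sub_zero]

lemma reLp_I_smul_ofRealLp_sub (a b : Lp ℝ 2 μ) :
    reLp μ (Complex.I • (ofRealLp μ a - Complex.I • ofRealLp μ b)) = b := by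
  rw [smul_sub, map_sub, reLp_I_smul_ofRealLp, reLp_I_smul_I_smul, reLp_ofRealLp, zero_sub, neg_neg]

/-- The complex-linear extension of an operator on real `L²`. -/
noncomputable def complexify (T : Lp ℝ 2 μ →L[ℝ] Lp ℝ 2 μ) : Lp ℂ 2 μ →ₗ[ℂ] Lp ℂ 2 μ where
  toFun f := ofRealLp μ (T (reLp μ f)) - Complex.I • ofRealLp μ (T (reLp μ (Complex.I • f)))
  map_add' f g := by
    simp only [smul_add, map_add]
    abel
  map_smul' c f := by
    rw [RingHom.id_apply]
    apply Lp_complex_ext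
    · rw [reLp_ofRealLp_sub, reLp_smul c, reLp_smul c, reLp_ofRealLp_sub, reLp_I_smul_ofRealLp_sub]
      simp only [map_add, map_smul]
    · rw [reLp_I_smul_ofRealLp_sub, smul_comm Complex.I c, smul_comm Complex.I c, reLp_smul c,
        reLp_smul c, reLp_I_smul_ofRealLp_sub, reLp_I_smul_I_smul, reLp_I_smul_I_smul,
        reLp_ofRealLp_sub]
      simp only [map_add, map_smul, map_neg]

lemma reLp_complexify (T : Lp ℝ 2 μ →L[ℝ] Lp ℝ 2 μ) (f : Lp ℂ 2 μ) :
    reLp μ (complexify T f) = T (reLp μ f) :=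
  reLp_ofRealLp_sub _ _

lemma norm_complexify_le {T : Lp ℝ 2 μ →L[ℝ] Lp ℝ 2 μ} (hT : ‖T‖ ≤ 1) (f : Lp ℂ 2 μ) :
    ‖complexify T f‖ ≤ 1 * ‖f‖ := by
  rw [one_mul]
  refine (sq_le_sq₀ (norm_nonneg _) (norm_nonneg _)).1 ?_
  rw [norm_sq_eq_reLp f, norm_sq_eq_reLp (complexify T f), ← map_smul, reLp_complexify,
    reLp_complexify]
  have h : ∀ g, ‖T g‖ ≤ ‖g‖ := fun g => (T.le_of_opNorm_le hT g).trans_eq (one_mul _)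
  gcongr <;> exact h _

lemma complexify_ofRealLp (T : Lp ℝ 2 μ →L[ℝ] Lp ℝ 2 μ) (f : Lp ℝ 2 μ) :
    complexify T (ofRealLp μ f) = ofRealLp μ (T f) := by
  apply Lp_complex_ext
  · rw [reLp_complexify, reLp_ofRealLp, reLp_ofRealLp]
  · rw [← map_smul, reLp_complexify, reLp_I_smul_ofRealLp, reLp_I_smul_ofRealLp, map_zero]

/-- A function in `L²(ℂ)` is dominated by `R` as soon as all its rotated real parts are. -/
lemma norm_le_of_reLp_smul_le {g : Lp ℂ 2 μ} {R : Lp ℝ 2 μ}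
    (h : ∀ b : ℂ, ‖b‖ = 1 → reLp μ (b • g) ≤ R) : ‖g‖ ≤ ‖R‖ := by
  have hae : ∀ᵐ x ∂μ, ∀ n : ℕ,
      ((TopologicalSpace.denseSeq Circle n : ℂ) * g x).re ≤ R x := by
    rw [ae_all_iff]
    intro n
    filter_upwards [
      (Lp.coeFn_le _ _).2 (h _ (Circle.norm_coe (TopologicalSpace.denseSeq Circle n))),
      coeFn_reLp_smul (TopologicalSpace.denseSeq Circle n : ℂ) g] with x h1 h2
    rwa [← h2]
  refine Lp.norm_le_norm_of_ae_le ?_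
  filter_upwards [hae] with x hx
  have hclosed : IsClosed {b : Circle | ((b : ℂ) * g x).re ≤ R x} :=
    isClosed_le (by fun_prop) continuous_const
  have hall : ∀ b : Circle, ((b : ℂ) * g x).re ≤ R x := fun b =>
    hclosed.closure_subset_iff.2 (by rintro _ ⟨n, rfl⟩; exact hx n)
      ((TopologicalSpace.denseRange_denseSeq Circle) b)
  refine le_trans ?_ (le_abs_self (R x))
  have := hall (Circle.exp (-(g x).arg))
  have e : (Circle.exp (-(g x).arg) : ℂ) * g x = (‖g x‖ : ℂ) := by
    conv_lhs => rw [← Complex.norm_mul_exp_arg_mul_I (g x)]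
    rw [Circle.coe_exp, mul_left_comm, ← Complex.exp_add]
    simp
  rwa [e, Complex.ofReal_re] at this

end Complexification

section Domination

variable {Ω : Type*} [MeasurableSpace Ω] {μ : Measure Ω}

lemma min_re_mul_re_le {ω : ℂ} {κ : ℝ} (hκ : ‖ω + 1‖ ≤ 2 * κ) (w : ℂ) :
    min (ω * w).re w.re ≤ κ * ‖w‖ := by
  have h : ((ω + 1) * w).re ≤ 2 * κ * ‖w‖ :=
    (Complex.re_le_norm _).trans (by rw [norm_mul]; gcongr)
  rw [add_mul, one_mul, Complex.add_re] at h
  linarith [min_le_left (ω * w).re w.re, min_le_right (ω * w).re w.re]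

/-- There is `F` with `|F| = |f|` which separates the directions in which `Re (ω b f)` and
`Re (b f)` are large. -/
lemma exists_separating {ω b : ℂ} {κ : ℝ} (hω : ‖ω‖ = 1) (hb : ‖b‖ = 1)
    (hκ : ‖ω + 1‖ ≤ 2 * κ) {f : Lp ℂ 2 μ} {r : Lp ℝ 2 μ} (hr : r =ᵐ[μ] fun x => ‖f x‖) :
    ∃ F : Lp ℝ 2 μ, |F| ≤ r ∧
      reLp μ ((2 * ω * b) • f) ≤ (1 - κ) • F + (1 + κ) • r ∧
      reLp μ ((2 * b) • f) ≤ -((1 - κ) • F) + (1 + κ) • r := by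
  classical
  let φ : Ω → ℝ := fun x => if (b * f x).re ≤ (ω * (b * f x)).re then ‖f x‖ else -‖f x‖
  have hf : Measurable f := (Lp.stronglyMeasurable f).measurable
  have hφm : Measurable φ :=
    Measurable.ite (measurableSet_le (by fun_prop) (by fun_prop)) (by fun_prop) (by fun_prop)
  have hφabs : ∀ x, |φ x| = ‖f x‖ := fun x => by
    simp only [φ]
    split_ifs <;> simp
  have hφ : MemLp φ 2 μ := (Lp.memLp f).of_le hφm.aestronglyMeasurable
    (Eventually.of_forall fun x => (hφabs x).le)
  refine ⟨hφ.toLp φ, ?_, ?_, ?_⟩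
  · rw [← Lp.coeFn_le]
    filter_upwards [Lp.coeFn_abs (hφ.toLp φ), hφ.coeFn_toLp, hr] with x h1 h2 h3
    rw [h1, h2, h3, hφabs]
  · rw [← Lp.coeFn_le]
    filter_upwards [coeFn_reLp_smul (2 * ω * b) f, hφ.coeFn_toLp, hr,
      Lp.coeFn_add ((1 - κ) • hφ.toLp φ) ((1 + κ) • r), Lp.coeFn_smul (1 - κ) (hφ.toLp φ),
      Lp.coeFn_smul (1 + κ) r] with x h1 h2 h3 h4 h5 h6
    rw [h1, h4, Pi.add_apply, h5, h6, Pi.smul_apply, Pi.smul_apply, h2, h3, smul_eq_mul,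
      smul_eq_mul]
    have hn : ‖b * f x‖ = ‖f x‖ := by rw [norm_mul, hb, one_mul]
    have e : (2 * ω * b * f x).re = 2 * (ω * (b * f x)).re := by
      rw [mul_assoc, mul_assoc, show (2 : ℂ) = ((2 : ℝ) : ℂ) by norm_num, Complex.re_ofReal_mul]
    rw [e]
    simp only [φ]
    split_ifs with hc
    · have := Complex.re_le_norm (ω * (b * f x))
      rw [norm_mul, hω, one_mul, hn] at this
      linarith
    · have := min_re_mul_re_le hκ (b * f x)
      rw [min_eq_left (not_le.1 hc).le, hn] at this
      linarith
  · rw [← Lp.coeFn_le]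
    filter_upwards [coeFn_reLp_smul (2 * b) f, hφ.coeFn_toLp, hr,
      Lp.coeFn_add (-((1 - κ) • hφ.toLp φ)) ((1 + κ) • r), Lp.coeFn_neg ((1 - κ) • hφ.toLp φ),
      Lp.coeFn_smul (1 - κ) (hφ.toLp φ),
      Lp.coeFn_smul (1 + κ) r] with x h1 h2 h3 h4 h7 h5 h6
    rw [h1, h4, Pi.add_apply, h7, Pi.neg_apply, h5, h6, Pi.smul_apply, Pi.smul_apply, h2, h3,
      smul_eq_mul, smul_eq_mul]
    have hn : ‖b * f x‖ = ‖f x‖ := by rw [norm_mul, hb, one_mul]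
    have e : (2 * b * f x).re = 2 * (b * f x).re := by
      rw [mul_assoc, show (2 : ℂ) = ((2 : ℝ) : ℂ) by norm_num, Complex.re_ofReal_mul]
    rw [e]
    simp only [φ]
    split_ifs with hc
    · have := min_re_mul_re_le hκ (b * f x)
      rw [min_eq_right hc, hn] at this
      linarith
    · have := Complex.re_le_norm (b * f x)
      rw [hn] at this
      linarith

lemma monotone_of_nonneg {A : Lp ℝ 2 μ →L[ℝ] Lp ℝ 2 μ}
    (hA : ∀ f : Lp ℝ 2 μ, 0 ≤ f → 0 ≤ A f) : Monotone A := fun f g hfg => by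
  have := hA (g - f) (sub_nonneg.2 hfg)
  rwa [map_sub, sub_nonneg] at this

/-- If `D` dominates the difference of the positive contractions `A` and `B`, then `ω A f` and
`B f` can nearly reinforce each other only if `‖D‖` is close to `2`. -/
lemma two_mul_norm_smul_add_le {A B D : Lp ℝ 2 μ →L[ℝ] Lp ℝ 2 μ}
    (hA : ∀ f : Lp ℝ 2 μ, 0 ≤ f → 0 ≤ A f) (hB : ∀ f : Lp ℝ 2 μ, 0 ≤ f → 0 ≤ B f)
    (hA1 : ‖A‖ ≤ 1) (hB1 : ‖B‖ ≤ 1)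
    (hD : ∀ g r : Lp ℝ 2 μ, |g| ≤ r → |(A - B) g| ≤ D r)
    {A' B' : Lp ℂ 2 μ →L[ℂ] Lp ℂ 2 μ} (hA' : ∀ f, reLp μ (A' f) = A (reLp μ f))
    (hB' : ∀ f, reLp μ (B' f) = B (reLp μ f))
    {ω : ℂ} {κ : ℝ} (hω : ‖ω‖ = 1) (hκ : ‖ω + 1‖ ≤ 2 * κ) (hκ1 : κ ≤ 1) (f : Lp ℂ 2 μ) :
    2 * ‖ω • A' f + B' f‖ ≤ ((1 - κ) * ‖D‖ + 2 * (1 + κ)) * ‖f‖ := by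
  have hκ0 : 0 ≤ κ := by linarith [norm_nonneg (ω + 1)]
  have hmem : MemLp (fun x => ‖f x‖) 2 μ := (Lp.memLp f).norm
  set r : Lp ℝ 2 μ := hmem.toLp _ with hrdef
  have hr : r =ᵐ[μ] fun x => ‖f x‖ := hmem.coeFn_toLp
  have hrnorm : ‖r‖ = ‖f‖ := by
    apply le_antisymm <;> refine Lp.norm_le_norm_of_ae_le ?_ <;>
      filter_upwards [hr] with x hx <;> simp [hx]
  have hdom : ∀ b : ℂ, ‖b‖ = 1 → reLp μ (b • (2 : ℂ) • (ω • A' f + B' f)) ≤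
      (1 - κ) • D r + (1 + κ) • (A r + B r) := by
    intro b hb
    obtain ⟨F, hF, h1, h2⟩ := exists_separating hω hb hκ hr
    have h1' := monotone_of_nonneg hA h1
    have h2' := monotone_of_nonneg hB h2
    have hDF : (A - B) F ≤ D r := (le_abs_self _).trans (hD F r hF)
    have h3 : (1 - κ) • (A - B) F ≤ (1 - κ) • D r := by
      rw [← Lp.coeFn_le] at hDF ⊢
      filter_upwards [hDF, Lp.coeFn_smul (1 - κ) ((A - B) F), Lp.coeFn_smul (1 - κ) (D r)]
        with x h h' h''
      rw [h', h'']
      exact mul_le_mul_of_nonneg_left h (sub_nonneg.2 hκ1)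
    rw [← hA'] at h1'
    rw [← hB'] at h2'
    have e : b • (2 : ℂ) • (ω • A' f + B' f) = A' ((2 * ω * b) • f) + B' ((2 * b) • f) := by
      simp only [map_smul]
      module
    rw [e, map_add]
    calc _ ≤ A ((1 - κ) • F + (1 + κ) • r) + B (-((1 - κ) • F) + (1 + κ) • r) := add_le_add h1' h2'
      _ = (1 - κ) • (A - B) F + (1 + κ) • (A r + B r) := by
        simp only [map_add, map_smul, map_neg, sub_apply]
        module
      _ ≤ _ := by gcongr
  have hle := norm_le_of_reLp_smul_le hdom
  have hAr : ‖A r‖ ≤ ‖f‖ := ((A.le_of_opNorm_le hA1 r).trans_eq (one_mul _)).trans_eq hrnorm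
  have hBr : ‖B r‖ ≤ ‖f‖ := ((B.le_of_opNorm_le hB1 r).trans_eq (one_mul _)).trans_eq hrnorm
  have hDr : ‖D r‖ ≤ ‖D‖ * ‖f‖ := (D.le_opNorm r).trans_eq (by rw [hrnorm])
  calc 2 * ‖ω • A' f + B' f‖ = ‖(2 : ℂ) • (ω • A' f + B' f)‖ := by rw [norm_smul]; simp
    _ ≤ ‖(1 - κ) • D r + (1 + κ) • (A r + B r)‖ := hle
    _ ≤ (1 - κ) * ‖D r‖ + (1 + κ) * (‖A r‖ + ‖B r‖) := by
      refine (norm_add_le _ _).trans ?_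
      rw [norm_smul, norm_smul, Real.norm_of_nonneg (sub_nonneg.2 hκ1),
        Real.norm_of_nonneg (by linarith)]
      gcongr
      exact norm_add_le _ _
    _ ≤ (1 - κ) * (‖D‖ * ‖f‖) + (1 + κ) * (‖f‖ + ‖f‖) := by
      have := sub_nonneg.2 hκ1
      gcongr
    _ = _ := by ring

end Domination

lemma norm_pow_le_one {E : Type*} [NormedAddCommGroup E] [NormedSpace ℝ E] {T : E →L[ℝ] E}
    (hT : ‖T‖ ≤ 1) (n : ℕ) : ‖T ^ n‖ ≤ 1 := by
  induction n with
  | zero => exact ContinuousLinearMap.norm_id_le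
  | succ n ih =>
    rw [pow_succ]
    exact (norm_mul_le _ _).trans (mul_le_one₀ ih (norm_nonneg _) hT)

lemma antitone_norm_pow_succ_sub_pow {E : Type*} [NormedAddCommGroup E] [NormedSpace ℝ E]
    {T : E →L[ℝ] E} (hT : ‖T‖ ≤ 1) : Antitone fun n : ℕ => ‖T ^ (n + 1) - T ^ n‖ := by
  refine antitone_nat_of_succ_le fun n => ?_
  have : T ^ (n + 1 + 1) - T ^ (n + 1) = T * (T ^ (n + 1) - T ^ n) := by
    rw [mul_sub, ← pow_succ', ← pow_succ']
  rw [this]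
  exact (norm_mul_le _ _).trans (mul_le_of_le_one_left (norm_nonneg _) hT)

/-- The case `p = 2` of the "zero-two" law: let `T` be a positive linear contraction on
`L²(μ)` of a σ-finite measure space. If for some `m ∈ ℕ ∪ {0}` the modulus `D` of
`T^{m+1} - T^m` exists and satisfies `‖D‖ < 2`, then `‖T^{n+1} - T^n‖ → 0`. -/
theorem zero_two_law_L2 {Ω : Type*} [MeasurableSpace Ω] (μ : Measure Ω) [SigmaFinite μ]
    (T : Lp ℝ 2 μ →L[ℝ] Lp ℝ 2 μ)
    (hTpos : ∀ f : Lp ℝ 2 μ, 0 ≤ f → 0 ≤ T f) (hT : ‖T‖ ≤ 1)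
    (m : ℕ) (D : Lp ℝ 2 μ →L[ℝ] Lp ℝ 2 μ)
    (hDpos : ∀ f : Lp ℝ 2 μ, 0 ≤ f → 0 ≤ D f)
    (hDmod : ∀ f : Lp ℝ 2 μ, 0 ≤ f →
      IsLUB {h : Lp ℝ 2 μ | ∃ g : Lp ℝ 2 μ, |g| ≤ f ∧ h = |(T ^ (m + 1) - T ^ m) g|} (D f))
    (hD : ‖D‖ < 2) :
    Tendsto (fun n : ℕ => ‖T ^ (n + 1) - T ^ n‖) atTop (nhds 0) := by
  suffices hsmall : ∀ c > 0, ∃ n, ‖T ^ (n + 1) - T ^ n‖ < c by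
    rw [Metric.tendsto_atTop]
    intro c hc
    obtain ⟨N, hN⟩ := hsmall c hc
    refine ⟨N, fun n hn => ?_⟩
    rw [Real.dist_eq, sub_zero, abs_of_nonneg (norm_nonneg _)]
    exact (antitone_norm_pow_succ_sub_pow hT hn).trans_lt hN
  by_contra! hcon
  obtain ⟨c, hc, hlow⟩ := hcon
  let S : Lp ℂ 2 μ →L[ℂ] Lp ℂ 2 μ := (complexify T).mkContinuous 1 (norm_complexify_le hT)
  have hS1 : ‖S‖ ≤ 1 := LinearMap.mkContinuous_norm_le _ zero_le_one _
  have hSre : ∀ n f, reLp μ ((S ^ n) f) = (T ^ n) (reLp μ f) := by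
    intro n
    induction n with
    | zero => simp
    | succ n ih =>
      intro f
      rw [pow_succ, pow_succ, mul_apply_eq_comp, mul_apply_eq_comp, ih]
      exact congrArg _ (reLp_complexify T f)
  have hSof : ∀ n f, (S ^ n) (ofRealLp μ f) = ofRealLp μ ((T ^ n) f) := by
    intro n
    induction n with
    | zero => simp
    | succ n ih =>
      intro f
      rw [pow_succ, pow_succ, mul_apply_eq_comp, mul_apply_eq_comp, ← ih]
      exact congrArg _ (complexify_ofRealLp T f)
  have hTnpos : ∀ n (f : Lp ℝ 2 μ), 0 ≤ f → 0 ≤ (T ^ n) f := by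
    intro n
    induction n with
    | zero => simp
    | succ n ih =>
      intro f hf
      rw [pow_succ, mul_apply_eq_comp]
      exact ih _ (hTpos f hf)
  have hvec : ∀ n : ℕ, ∃ x : Lp ℂ 2 μ, ‖x‖ ≤ 1 ∧ c / 2 ≤ ‖(S ^ n) (S x - x)‖ := by
    intro n
    obtain ⟨x, hx, hxc⟩ := (T ^ (n + 1) - T ^ n).exists_lt_apply_of_lt_opNorm
      (lt_of_lt_of_le (half_lt_self hc) (hlow n))
    refine ⟨ofRealLp μ x, (norm_ofRealLp x).le.trans hx.le, ?_⟩
    rw [map_sub, ← mul_apply_eq_comp, ← pow_succ, hSof, hSof, ← map_sub, norm_ofRealLp]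
    exact hxc.le
  set κ : ℝ := Real.sqrt (1 - c ^ 2 / 64) with hκdef
  have hκ1 : κ < 1 := by
    rw [hκdef, Real.sqrt_lt' one_pos]
    have : 0 < c ^ 2 := by positivity
    linarith
  set ε : ℝ := (1 - κ) * (2 - ‖D‖) / (4 * (2 * m + 1)) with hεdef
  have hgap : 0 < (1 - κ) * (2 - ‖D‖) := mul_pos (by linarith) (by linarith)
  have hε : 0 < ε := by positivity
  obtain ⟨ω, f, hω, hωc, hf, hfε⟩ := exists_approx_eigenvector hS1 (half_pos hc) hvec hε
  have hκ : ‖ω + 1‖ ≤ 2 * κ := by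
    have hpar := parallelogram_law_with_norm ℝ ω 1
    rw [hω, norm_one] at hpar
    have : ‖ω + 1‖ / 2 ≤ κ := Real.le_sqrt_of_sq_le (by nlinarith)
    linarith
  have hmain := two_mul_norm_smul_add_le (hTnpos (m + 1)) (hTnpos m) (norm_pow_le_one hT _)
    (norm_pow_le_one hT _)
    (fun g r hg => (hDmod r ((abs_nonneg g).trans hg)).1 ⟨g, hg, rfl⟩)
    (hSre (m + 1)) (hSre m) hω hκ hκ1.le f
  have hstep : ∀ k : ℕ, ‖ω • (S ^ (k + 1)) f - (S ^ k) f‖ ≤ ε * ‖f‖ := by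
    intro k
    rw [pow_succ, mul_apply_eq_comp, ← map_smul, ← map_sub]
    exact (norm_pow_apply_le hS1 _ _).trans hfε
  have hiter : ∀ k : ℕ, (1 - k * ε) * ‖f‖ ≤ ‖(S ^ k) f‖ := by
    intro k
    induction k with
    | zero => simp
    | succ k ih =>
      have h1 := hstep k
      have h2 := norm_sub_norm_le ((S ^ k) f) (ω • (S ^ (k + 1)) f)
      rw [norm_sub_rev, norm_smul, hω, one_mul] at h2
      rw [Nat.cast_succ]
      linarith
  have hsum : 2 * ‖(S ^ m) f‖ - ε * ‖f‖ ≤ ‖ω • (S ^ (m + 1)) f + (S ^ m) f‖ := by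
    have h1 := hstep m
    have e : (2 : ℂ) • (S ^ m) f = (ω • (S ^ (m + 1)) f + (S ^ m) f)
        - (ω • (S ^ (m + 1)) f - (S ^ m) f) := by
      module
    have h2 := norm_sub_le (ω • (S ^ (m + 1)) f + (S ^ m) f) (ω • (S ^ (m + 1)) f - (S ^ m) f)
    rw [← e, norm_smul, Complex.norm_two] at h2
    linarith
  have hfinal : (4 - 2 * (2 * m + 1) * ε) * ‖f‖ ≤ ((1 - κ) * ‖D‖ + 2 * (1 + κ)) * ‖f‖ := by
    linarith [hiter m]
  have hcoef := le_of_mul_le_mul_right hfinal hf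
  have hεeq : 2 * (2 * m + 1) * ε = (1 - κ) * (2 - ‖D‖) / 2 := by
    rw [hεdef]
    field_simp
    ring
  linarith
end
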